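/- arXiv:1407.2829 — 3 statements merged into one kernel-verified Lean document; each statement's English description precedes it below -/
import Mathlib

section
/- For every positive integer n, the iterated constant term CT_{x_n} CT_{x_{n-1}} ⋯ CT_{x_1} of the rational function ∏_{i=1}^n x_i^{-1} (1 - x_i)^{-2} · ∏_{1 ≤ i < j ≤ n} (x_j - x_i)^{-1} (1 - x_j - x_i)^{-1} equals 2^{n²} · ∏_{k=1}^{n} Cat(k), where Cat(k) = (2k)!/(k!·(k+1)!) is the k-th Catalan number. (This is the Mészáros–Morales conjecture on the volume of the D_n analog of the Chan–Robbins–Yuen polytope.) -/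
/-- The iterated formal Laurent series field `ℚ((x_n))((x_{n-1}))⋯((x_1))`,
bundled with its field structure (built by recursion on the number of variables;
each step adjoins one more (outer) Laurent variable). -/
noncomputable def IterLSAux : ℕ → (α : Type) × Field α
  | 0 => ⟨ℚ, inferInstance⟩
  | n + 1 =>
    letI p := IterLSAux n
    letI := p.2
    ⟨LaurentSeries p.1, inferInstance⟩

/-- The iterated Laurent series field in `n` variables over `ℚ`:
`IterLS n = ℚ((x_n))((x_{n-1}))⋯((x_1))`, the variable with the smallest index
being the outermost one. -/
noncomputable def IterLS (n : ℕ) : Type := (IterLSAux n).1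

noncomputable instance (n : ℕ) : Field (IterLS n) := (IterLSAux n).2

/-- The iterated constant term `CT_{x_n} CT_{x_{n-1}} ⋯ CT_{x_1}` : first take the
coefficient of `x_1^0` (the outermost variable), then of `x_2^0`, etc.; i.e. extract
the coefficient of the monomial `x_1^0 x_2^0 ⋯ x_n^0`. -/
noncomputable def IterLS.CT : (n : ℕ) → IterLS n → ℚ
  | 0, q => q
  | n + 1, f => IterLS.CT n ((show LaurentSeries (IterLS n) from f).coeff 0)

/-- The variables `x_1, …, x_n` as elements of `IterLS n`; the index `i : Fin n`
corresponds to `x_{i+1}`, and `var n 0 = x_1` is the outermost Laurent variable. -/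
noncomputable def IterLS.var : (n : ℕ) → Fin n → IterLS n
  | n + 1, i =>
    Fin.cases (show LaurentSeries (IterLS n) from HahnSeries.single (1 : ℤ) 1)
      (fun j => show LaurentSeries (IterLS n) from HahnSeries.C (IterLS.var n j)) i


/-- A field with `n` coordinates, the partial derivatives along them and a residue functional. -/
structure ResData (K : Type) [Field K] (n : ℕ) where
  x : Fin n → K
  D : Fin n → K →+ K
  res : K →+ ℚ
  leib : ∀ i a b, D i (a * b) = a * D i b + b * D i a
  Dx : ∀ i j, D i (x j) = if j = i then 1 else 0
  resD : ∀ i f, res (D i f) = 0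
  x_ne : ∀ i, x i ≠ 0
  one_sub_ne : ∀ i, 1 - x i ≠ 0
  sub_ne : ∀ i j, i ≠ j → x j - x i ≠ 0
  one_sub_sub_ne : ∀ i j, i ≠ j → 1 - x j - x i ≠ 0

namespace ResData

variable {K : Type} [Field K] {n : ℕ} (R : ResData K n)

lemma D_one (i : Fin n) : R.D i 1 = 0 := by
  have h := R.leib i 1 1
  simpa using h

lemma D_natCast (i : Fin n) (t : ℕ) : R.D i (t : K) = 0 := by
  induction t with
  | zero => simp
  | succ t ih => rw [Nat.cast_succ, map_add, ih, D_one, add_zero]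

lemma D_inv (i : Fin n) {a : K} (ha : a ≠ 0) : R.D i a⁻¹ = a⁻¹ * (-(R.D i a / a)) := by
  have h := R.leib i a a⁻¹
  rw [mul_inv_cancel₀ ha, D_one] at h
  field_simp at h ⊢
  linear_combination (-1) * h

lemma D_prod {ι : Type} [DecidableEq ι] (i : Fin n) (s : Finset ι) (f : ι → K)
    (hf : ∀ k ∈ s, f k ≠ 0) :
    R.D i (∏ k ∈ s, f k) = (∏ k ∈ s, f k) * ∑ k ∈ s, R.D i (f k) / f k := by
  induction s using Finset.induction_on with
  | empty => simp [D_one]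
  | insert a s ha ih =>
    rw [Finset.prod_insert ha, Finset.sum_insert ha, R.leib,
      ih (fun k hk => hf k (Finset.mem_insert_of_mem hk))]
    have := hf a (Finset.mem_insert_self _ _)
    field_simp
    ring

lemma D_prod_zero {ι : Type} [DecidableEq ι] (i : Fin n) (s : Finset ι) (f : ι → K)
    (hf : ∀ k ∈ s, R.D i (f k) = 0) :
    R.D i (∏ k ∈ s, f k) = 0 := by
  induction s using Finset.induction_on with
  | empty => simp [D_one]
  | insert a s ha ih =>
    rw [Finset.prod_insert ha, R.leib,
      ih (fun k hk => hf k (Finset.mem_insert_of_mem hk)), hf a (Finset.mem_insert_self _ _)]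
    simp

/-- The new coordinate `y = x (1 - x)`. -/
def y (i : Fin n) : K := R.x i * (1 - R.x i)

lemma y_ne (i : Fin n) : R.y i ≠ 0 := mul_ne_zero (R.x_ne i) (R.one_sub_ne i)

lemma y_sub (i j : Fin n) : R.y j - R.y i = (R.x j - R.x i) * (1 - R.x j - R.x i) := by
  unfold y; ring

lemma y_sub_ne {i j : Fin n} (h : i ≠ j) : R.y j - R.y i ≠ 0 := by
  rw [y_sub]; exact mul_ne_zero (R.sub_ne i j h) (R.one_sub_sub_ne i j h)

lemma Dy (i j : Fin n) : R.D i (R.y j) = if j = i then 1 - 2 * R.x i else 0 := by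
  unfold y
  rw [R.leib, map_sub, D_one, Dx]
  split_ifs with h
  · subst h; ring
  · simp

/-- The Vandermonde product in `y`. -/
def V : K := ∏ i : Fin n, ∏ j ∈ Finset.Ioi i, (R.y j - R.y i)

lemma V_ne : R.V ≠ 0 := by
  unfold V
  refine Finset.prod_ne_zero_iff.2 fun i _ => Finset.prod_ne_zero_iff.2 fun j hj => ?_
  exact R.y_sub_ne (ne_of_lt (Finset.mem_Ioi.1 hj))

lemma DV (i : Fin n) : R.D i R.V =
    R.V * ((1 - 2 * R.x i) * ∑ j ∈ Finset.univ.erase i, (R.y i - R.y j)⁻¹) := by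
  unfold V
  rw [R.D_prod]
  swap
  · intro k _
    refine Finset.prod_ne_zero_iff.2 fun j hj => ?_
    exact R.y_sub_ne (ne_of_lt (Finset.mem_Ioi.1 hj))
  congr 1
  have h1 : ∀ k : Fin n, R.D i (∏ j ∈ Finset.Ioi k, (R.y j - R.y k)) /
      (∏ j ∈ Finset.Ioi k, (R.y j - R.y k)) =
      ∑ j ∈ Finset.Ioi k, R.D i (R.y j - R.y k) / (R.y j - R.y k) := by
    intro k
    have hne : ∀ j ∈ Finset.Ioi k, R.y j - R.y k ≠ 0 := fun j hj =>
      R.y_sub_ne (ne_of_lt (Finset.mem_Ioi.1 hj))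
    rw [R.D_prod i _ _ hne, mul_div_cancel_left₀]
    exact Finset.prod_ne_zero_iff.2 hne
  simp only [h1]
  have h2 : ∀ k j : Fin n, R.D i (R.y j - R.y k) / (R.y j - R.y k) =
      (if j = i then (1 - 2 * R.x i) * (R.y i - R.y k)⁻¹ else 0) +
      (if k = i then (1 - 2 * R.x i) * (R.y i - R.y j)⁻¹ else 0) := by
    intro k j
    rw [map_sub, Dy, Dy]
    by_cases hj : j = i <;> by_cases hk : k = i
    · subst hj; subst hk; simp
    · subst hj; simp [hk, div_eq_mul_inv]
    · subst hk
      simp only [hj, if_false, if_true, zero_sub, zero_add]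
      rw [← neg_sub (R.y k) (R.y j), neg_div_neg_eq, div_eq_mul_inv]
    · simp [hj, hk]
  simp only [h2, Finset.sum_add_distrib]
  rw [Finset.mul_sum]
  have e1 : ∑ k : Fin n, ∑ j ∈ Finset.Ioi k,
      (if j = i then (1 - 2 * R.x i) * (R.y i - R.y k)⁻¹ else 0) =
      ∑ k ∈ Finset.Iio i, (1 - 2 * R.x i) * (R.y i - R.y k)⁻¹ := by
    simp only [Finset.sum_ite_eq', Finset.mem_Ioi]
    rw [← Finset.sum_filter]
    refine Finset.sum_congr ?_ fun _ _ => rfl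
    ext; simp
  have e2 : ∑ k : Fin n, ∑ j ∈ Finset.Ioi k,
      (if k = i then (1 - 2 * R.x i) * (R.y i - R.y j)⁻¹ else 0) =
      ∑ j ∈ Finset.Ioi i, (1 - 2 * R.x i) * (R.y i - R.y j)⁻¹ := by
    rw [Finset.sum_eq_single i]
    · simp
    · intro b _ hb; simp [hb]
    · simp
  rw [e1, e2, ← Finset.sum_union]
  · refine Finset.sum_congr ?_ fun _ _ => rfl
    ext k; simp [lt_or_lt_iff_ne]
  · rw [Finset.disjoint_left]; intro a; simp; exact fun h => h.le

/-- The basic weight `∏ y_i⁻² / V`. -/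
def W : K := (∏ i, R.y i)⁻¹ * (∏ i, R.y i)⁻¹ * R.V⁻¹

lemma DW (i : Fin n) : R.D i R.W =
    R.W * ((1 - 2 * R.x i) *
      (-2 * (R.y i)⁻¹ - ∑ j ∈ Finset.univ.erase i, (R.y i - R.y j)⁻¹)) := by
  have hP : (∏ i, R.y i) ≠ 0 := Finset.prod_ne_zero_iff.2 fun i _ => R.y_ne i
  have hDP : R.D i (∏ i, R.y i) = (∏ i, R.y i) * ((1 - 2 * R.x i) * (R.y i)⁻¹) := by
    rw [R.D_prod i _ _ (fun k _ => R.y_ne k)]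
    congr 1
    rw [Finset.sum_eq_single i]
    · rw [Dy, if_pos rfl, div_eq_mul_inv]
    · intro b _ hb; rw [Dy, if_neg hb, zero_div]
    · simp
  unfold W
  rw [R.leib, R.leib, R.D_inv i hP, R.D_inv i R.V_ne, DV, hDP, mul_div_cancel_left₀ _ hP,
    mul_div_cancel_left₀ _ R.V_ne]
  ring

/-- `∏ (t + y_k)` over `k ≠ i`. -/
def Ph (t : K) (s : Finset (Fin n)) : K := ∏ k ∈ s, (t + R.y k)

lemma vf (t : ℕ) (i : Fin n) :
    R.D i ((1 - 2 * R.x i) * (R.y i * R.Ph t (Finset.univ.erase i)) * R.W) =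
    R.W * (-2 * (R.y i * R.Ph t (Finset.univ.erase i))
      + (1 - 4 * R.y i) * (- R.Ph t (Finset.univ.erase i)
      - ∑ j ∈ Finset.univ.erase i, (R.y i * R.Ph t (Finset.univ.erase i)) * (R.y i - R.y j)⁻¹)) := by
  have h0 : R.D i (R.Ph t (Finset.univ.erase i)) = 0 := by
    unfold Ph
    apply R.D_prod_zero
    intro k hk
    rw [map_add, D_natCast, Dy, if_neg (Finset.ne_of_mem_erase hk), add_zero]
  have h2 : R.D i (1 - 2 * R.x i) = -2 := by
    rw [map_sub, D_one, R.leib, Dx, if_pos rfl]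
    have := R.D_natCast i 2
    push_cast at this
    rw [this]; ring
  rw [R.leib, R.leib, R.leib, h0, h2, DW, Dy, if_pos rfl, ← Finset.mul_sum]
  have hy : R.y i ≠ 0 := R.y_ne i
  have hxy : (1 - 2 * R.x i) * (1 - 2 * R.x i) = 1 - 4 * R.y i := by unfold y; ring
  rw [← hxy]
  field_simp
  ring

lemma Ph_erase (t : K) {s : Finset (Fin n)} {i : Fin n} (hi : i ∈ s) :
    R.Ph t s = (t + R.y i) * R.Ph t (s.erase i) := (Finset.mul_prod_erase s _ hi).symm

lemma pair_sum (t : K) :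
    2 * ∑ i : Fin n, ∑ j ∈ Finset.univ.erase i,
      ((1 - 4 * R.y i) * (R.y i * R.Ph t (Finset.univ.erase i))) * (R.y i - R.y j)⁻¹ =
    (t + 4 * t ^ 2) * (∑ i : Fin n, ∑ j ∈ Finset.univ.erase i,
        R.Ph t ((Finset.univ.erase i).erase j))
      - 4 * (n * (n - 1)) * R.Ph t Finset.univ := by
  set g : Fin n → K := fun i => (1 - 4 * R.y i) * (R.y i * R.Ph t (Finset.univ.erase i)) with hg
  have swap : ∑ i : Fin n, ∑ j ∈ Finset.univ.erase i, g i * (R.y i - R.y j)⁻¹ =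
      ∑ i : Fin n, ∑ j ∈ Finset.univ.erase i, g j * (R.y j - R.y i)⁻¹ := by
    apply Finset.sum_comm'
    intro a b; simp [eq_comm]
  have hcount : (n * (n - 1) : K) * R.Ph t Finset.univ =
      ∑ i : Fin n, ∑ j ∈ Finset.univ.erase i, R.Ph t Finset.univ := by
    rcases n with _ | n
    · simp
    · simp [Finset.card_erase_of_mem]; ring
  rw [two_mul]
  nth_rewrite 2 [swap]
  rw [mul_assoc 4, hcount]
  simp only [Finset.mul_sum, ← Finset.sum_add_distrib, ← Finset.sum_sub_distrib]
  refine Finset.sum_congr rfl fun i _ => Finset.sum_congr rfl fun j hj => ?_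
  have hji := Finset.ne_of_mem_erase hj
  have hne := R.y_sub_ne hji
  have hne' := R.y_sub_ne hji.symm
  have e1 := R.Ph_erase t (Finset.mem_univ i)
  have e2 := R.Ph_erase t hj
  have e3 := R.Ph_erase t (s := Finset.univ.erase j) (i := i) (by simp [hji.symm])
  rw [Finset.erase_right_comm] at e3
  simp only [hg]
  rw [e1, e3, e2, ← neg_sub (R.y i) (R.y j), inv_neg]
  field_simp
  ring

lemma res_ode (t : ℕ) :
    R.res (R.W * (4 * (n : K) ^ 2 * R.Ph t Finset.univ
      - (2 + 4 * t) * (∑ i : Fin n, R.Ph t (Finset.univ.erase i))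
      - (t + 4 * t ^ 2) * (∑ i : Fin n, ∑ j ∈ Finset.univ.erase i,
        R.Ph t ((Finset.univ.erase i).erase j)))) = 0 := by
  have key : R.W * (4 * (n : K) ^ 2 * R.Ph t Finset.univ
      - (2 + 4 * t) * (∑ i : Fin n, R.Ph t (Finset.univ.erase i))
      - (t + 4 * t ^ 2) * (∑ i : Fin n, ∑ j ∈ Finset.univ.erase i,
        R.Ph t ((Finset.univ.erase i).erase j))) =
      ∑ i : Fin n, (R.D i ((1 - 2 * R.x i) * (R.y i * R.Ph t (Finset.univ.erase i)) * R.W) +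
        R.D i ((1 - 2 * R.x i) * (R.y i * R.Ph t (Finset.univ.erase i)) * R.W)) := by
    have hps := R.pair_sum (t : K)
    have h1 : ∀ i : Fin n,
        R.D i ((1 - 2 * R.x i) * (R.y i * R.Ph t (Finset.univ.erase i)) * R.W) +
        R.D i ((1 - 2 * R.x i) * (R.y i * R.Ph t (Finset.univ.erase i)) * R.W) =
        R.W * (4 * R.Ph t Finset.univ - (2 + 4 * t) * R.Ph t (Finset.univ.erase i)
          - 2 * ∑ j ∈ Finset.univ.erase i,
      ((1 - 4 * R.y i) * (R.y i * R.Ph t (Finset.univ.erase i))) * (R.y i - R.y j)⁻¹) := by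
      intro i
      rw [vf, R.Ph_erase t (Finset.mem_univ i), ← Finset.mul_sum, ← Finset.mul_sum]
      ring
    simp only [h1]
    rw [← Finset.mul_sum, Finset.sum_sub_distrib, Finset.sum_sub_distrib, ← Finset.mul_sum,
      ← Finset.mul_sum, ← Finset.mul_sum, hps]
    rw [Finset.sum_const, Finset.card_univ, Fintype.card_fin, nsmul_eq_mul]
    ring
  rw [key, map_sum]
  exact Finset.sum_eq_zero fun i _ => by rw [map_add, R.resD, add_zero]

open Polynomial in
/-- The polynomial `∏ (X + y_k)`. -/
noncomputable def P : K[X] := ∏ k : Fin n, (X + C (R.y k))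

open Polynomial in
lemma eval_Ph (t : K) (s : Finset (Fin n)) :
    (∏ k ∈ s, (X + C (R.y k))).eval t = R.Ph t s := by
  simp [Polynomial.eval_prod, Ph]

open Polynomial in
lemma deriv_prod (s : Finset (Fin n)) :
    derivative (∏ k ∈ s, (X + C (R.y k))) = ∑ i ∈ s, ∏ k ∈ s.erase i, (X + C (R.y k)) := by
  rw [derivative_prod_finset]
  simp

/-- The moments `res (W e_{n-m}(y))`. -/
noncomputable def c (m : ℕ) : ℚ := R.res (R.W * R.P.coeff m)

lemma res_natCast_mul (a : ℕ) (f : K) : R.res ((a : K) * f) = a * R.res f := by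
  rw [← nsmul_eq_mul, map_nsmul, nsmul_eq_mul]

open Polynomial in
lemma res_poly_zero (Q : K[X]) (h : ∀ t : ℕ, R.res (R.W * Q.eval (t : K)) = 0) (m : ℕ) :
    R.res (R.W * Q.coeff m) = 0 := by
  set S : ℚ[X] := ∑ k ∈ Finset.range (Q.natDegree + 1),
    C (R.res (R.W * Q.coeff k)) * X ^ k with hS
  have hev : ∀ t : ℕ, S.eval (t : ℚ) = 0 := by
    intro t
    rw [← h t, eval_eq_sum_range (p := Q), Finset.mul_sum, map_sum, hS, eval_finsetSum]
    refine Finset.sum_congr rfl fun k _ => ?_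
    rw [eval_mul, eval_C, eval_pow, eval_X]
    have : R.W * (Q.coeff k * (t : K) ^ k) = ((t ^ k : ℕ) : K) * (R.W * Q.coeff k) := by
      push_cast; ring
    rw [this, res_natCast_mul]
    push_cast; ring
  have hS0 : S = 0 := by
    apply Polynomial.eq_zero_of_infinite_isRoot
    refine Set.Infinite.mono ?_ (Set.infinite_range_of_injective (Nat.cast_injective (R := ℚ)))
    rintro _ ⟨t, rfl⟩
    exact hev t
  by_cases hm : m < Q.natDegree + 1
  · have h1 : S.coeff m = R.res (R.W * Q.coeff m) := by
      rw [hS, finsetSum_coeff]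
      simp only [coeff_C_mul_X_pow]
      rw [Finset.sum_ite_eq, if_pos (Finset.mem_range.2 hm)]
    rw [← h1, hS0, coeff_zero]
  · rw [coeff_eq_zero_of_natDegree_lt (by omega), mul_zero, map_zero]

open Polynomial in
lemma c_rec (m : ℕ) :
    ((m : ℚ) + 1) * (m + 2) * R.c (m + 1) = 4 * ((n : ℚ) ^ 2 - m ^ 2) * R.c m := by
  have h := R.res_poly_zero (C (4 * (n : K) ^ 2) * R.P - (C 2 + C 4 * X) * derivative R.P
    - (X + C 4 * X ^ 2) * derivative (derivative R.P)) (by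
      intro t
      rw [← R.res_ode t]
      congr 2
      have e1 : eval (t : K) (derivative R.P) = ∑ i : Fin n, R.Ph t (Finset.univ.erase i) := by
        rw [P, deriv_prod, eval_finsetSum]
        exact Finset.sum_congr rfl fun i _ => R.eval_Ph _ _
      have e2 : eval (t : K) (derivative (derivative R.P)) =
          ∑ i : Fin n, ∑ j ∈ Finset.univ.erase i, R.Ph t ((Finset.univ.erase i).erase j) := by
        rw [P, deriv_prod, derivative_sum, eval_finsetSum]
        refine Finset.sum_congr rfl fun i _ => ?_
        rw [deriv_prod, eval_finsetSum]
        exact Finset.sum_congr rfl fun j _ => R.eval_Ph _ _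
      have e0 : eval (t : K) R.P = R.Ph t Finset.univ := R.eval_Ph _ _
      simp only [eval_sub, eval_mul, eval_add, eval_C, eval_X, eval_pow, e0, e1, e2]) m
  have hc : R.W * (C (4 * (n : K) ^ 2) * R.P - (C 2 + C 4 * X) * derivative R.P
    - (X + C 4 * X ^ 2) * derivative (derivative R.P)).coeff m =
      ((4 * n ^ 2 : ℕ) : K) * (R.W * R.P.coeff m) - ((4 * m ^ 2 : ℕ) : K) * (R.W * R.P.coeff m)
       - (((m + 1) * (m + 2) : ℕ) : K) * (R.W * R.P.coeff (m + 1)) := by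
    have e : C (4 * (n : K) ^ 2) * R.P - (C 2 + C 4 * X) * derivative R.P
      - (X + C 4 * X ^ 2) * derivative (derivative R.P) =
      C (4 * (n : K) ^ 2) * R.P - C 2 * derivative R.P - C 4 * (X * derivative R.P)
      - X * derivative (derivative R.P) - C 4 * (X * (X * derivative (derivative R.P))) := by ring
    rw [e]
    simp only [coeff_sub, coeff_C_mul]
    rcases m with _ | _ | m
    · simp [coeff_derivative]; ring
    · simp [coeff_derivative, coeff_X_mul]; ring
    · simp [coeff_derivative, coeff_X_mul]; ring
  rw [hc, map_sub, map_sub, res_natCast_mul, res_natCast_mul, res_natCast_mul] at h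
  unfold c
  push_cast at h
  linear_combination -h

open Polynomial in
lemma c_n : R.c n = R.res R.W := by
  have hm : R.P.Monic := monic_prod_of_monic _ _ fun k _ => monic_X_add_C _
  have hd : R.P.natDegree = n := by
    unfold P
    rw [natDegree_prod_of_monic _ _ fun k _ => monic_X_add_C _]
    simp
  have : R.P.coeff n = 1 := by
    have h1 := hm.coeff_natDegree
    rwa [hd] at h1
  rw [c, this, mul_one]

open Polynomial in
lemma c_zero : R.c 0 = R.res (R.W * ∏ k, R.y k) := by
  rw [c, coeff_zero_eq_eval_zero]
  congr 2
  rw [P, eval_Ph]; simp [Ph]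

end ResData

lemma closed_form (N : ℕ) (c : ℕ → ℚ)
    (h : ∀ m : ℕ, ((m : ℚ) + 1) * (m + 2) * c (m + 1) = 4 * (((N + 1 : ℕ) : ℚ) ^ 2 - m ^ 2) * c m) :
    c (N + 1) = 2 ^ (2 * N + 1) * ((2 * (N + 1)).factorial : ℚ) /
      (((N + 1).factorial : ℚ) * ((N + 1 + 1).factorial : ℚ)) * c 0 := by
  have key : ∀ m k : ℕ, m + k = N + 1 →
      c m * m.factorial * (m + 1).factorial * k.factorial * N.factorial =
        4 ^ m * (N + 1).factorial * (N + m).factorial * c 0 := by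
    intro m
    induction m with
    | zero => intro k hk; rw [← hk]; simp; ring
    | succ m ih =>
      intro k hk
      have h1 := ih (k + 1) (by omega)
      have h2 := h m
      have hN : ((N + 1 : ℕ) : ℚ) = m + k + 1 := by rw [← hk]; push_cast; ring
      rw [hN] at h2
      have hN' : (N : ℚ) + 1 = m + k + 1 := by rw [← hN]; push_cast; ring
      rw [show N + (m + 1) = (N + m) + 1 by ring]
      rw [Nat.factorial_succ (N + m), Nat.factorial_succ (m + 1), Nat.factorial_succ m] at *
      rw [Nat.factorial_succ k] at h1
      push_cast at h1 h2 ⊢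
      have hN'' : (N : ℚ) = m + k := by linarith
      generalize (N.factorial : ℚ) = fN at *
      generalize ((N + 1).factorial : ℚ) = fN1 at *
      generalize ((N + m).factorial : ℚ) = fNm at *
      generalize (m.factorial : ℚ) = fm at *
      generalize (k.factorial : ℚ) = fk at *
      rw [hN''] at *
      linear_combination (fm * (m + 1) * fm * fk * fN) * h2 + 4 * (2 * m + k + 1) * h1
  have h1 := key (N + 1) 0 (by omega)
  have e : (2 * (N + 1)).factorial = 2 * (N + 1) * (N + (N + 1)).factorial := by
    rw [show 2 * (N + 1) = (N + (N + 1)) + 1 by ring, Nat.factorial_succ]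
  rw [e]
  have f1 : ((N + 1).factorial : ℚ) ≠ 0 := by positivity
  have f2 : ((N + 1 + 1).factorial : ℚ) ≠ 0 := by positivity
  have f3 : (N.factorial : ℚ) ≠ 0 := by positivity
  have e4 : (4 : ℚ) ^ (N + 1) = 2 * 2 ^ (2 * N + 1) := by
    rw [show (4 : ℚ) = 2 ^ 2 by norm_num, ← pow_mul]; ring
  have e3 : ((N + 1).factorial : ℚ) = (N + 1) * N.factorial := by
    rw [Nat.factorial_succ]; push_cast; ring
  rw [e4] at h1
  push_cast
  field_simp
  apply mul_left_cancel₀ f3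
  simp only [Nat.factorial_zero, Nat.cast_one, mul_one] at h1
  rw [e3] at h1 ⊢
  linear_combination h1

section Laurent

variable {K : Type} [Field K]

/-- Derivative of a Laurent series. -/
noncomputable def lsD : LaurentSeries K →+ LaurentSeries K :=
  (LaurentSeries.hasseDeriv K 1 : LaurentSeries K →ₗ[K] LaurentSeries K).toAddMonoidHom

lemma lsD_coeff (f : LaurentSeries K) (k : ℤ) :
    (lsD f).coeff k = ((k + 1 : ℤ) : K) * f.coeff (k + 1) := by
  have h := LaurentSeries.hasseDeriv_coeff (R := K) 1 f k
  rw [Ring.choose_one_right, zsmul_eq_mul] at h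
  exact h

lemma lsTheta_coeff (f : LaurentSeries K) (k : ℤ) :
    (HahnSeries.single 1 1 * lsD f : LaurentSeries K).coeff k = (k : K) * f.coeff k := by
  rw [HahnSeries.coeff_single_mul, lsD_coeff, one_mul]
  simp

lemma lsTheta_leib (f g : LaurentSeries K) :
    (HahnSeries.single 1 1 * lsD (f * g) : LaurentSeries K) =
      f * (HahnSeries.single 1 1 * lsD g) + g * (HahnSeries.single 1 1 * lsD f) := by
  ext k
  rw [lsTheta_coeff, mul_comm g, HahnSeries.coeff_add, HahnSeries.coeff_mul,
    HahnSeries.coeff_mul_right' (x := f) (y := HahnSeries.single 1 1 * lsD g) g.isPWO_support,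
    HahnSeries.coeff_mul_left' (y := g) (x := HahnSeries.single 1 1 * lsD f) f.isPWO_support,
    Finset.mul_sum, ← Finset.sum_add_distrib]
  · refine Finset.sum_congr rfl fun ij hij => ?_
    rw [lsTheta_coeff, lsTheta_coeff]
    have h : ij.1 + ij.2 = k := by
      simp only [Finset.mem_antidiagonal] at hij
      exact hij.2.2
    rw [← h]; push_cast; ring
  · intro a ha
    rw [HahnSeries.mem_support, lsTheta_coeff] at ha
    exact right_ne_zero_of_mul ha
  · intro a ha
    rw [HahnSeries.mem_support, lsTheta_coeff] at ha
    exact right_ne_zero_of_mul ha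

lemma lsX_ne : (HahnSeries.single 1 1 : LaurentSeries K) ≠ 0 := by
  simp

lemma lsD_leib (f g : LaurentSeries K) : lsD (f * g) = f * lsD g + g * lsD f := by
  apply mul_left_cancel₀ (lsX_ne (K := K))
  rw [lsTheta_leib]; ring

/-- Coefficientwise application of an additive map. -/
noncomputable def lsMap (d : K →+ K) : LaurentSeries K →+ LaurentSeries K where
  toFun f := HahnSeries.map f d
  map_zero' := by ext; simp
  map_add' f g := by ext; simp

lemma lsMap_coeff (d : K →+ K) (f : LaurentSeries K) (k : ℤ) :
    (lsMap d f).coeff k = d (f.coeff k) := rfl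

lemma lsMap_leib (d : K →+ K) (hd : ∀ a b, d (a * b) = a * d b + b * d a)
    (f g : LaurentSeries K) : lsMap d (f * g) = f * lsMap d g + g * lsMap d f := by
  ext k
  rw [lsMap_coeff, mul_comm g, HahnSeries.coeff_add, HahnSeries.coeff_mul,
    HahnSeries.coeff_mul_right' (x := f) (y := lsMap d g) g.isPWO_support,
    HahnSeries.coeff_mul_left' (y := g) (x := lsMap d f) f.isPWO_support,
    map_sum, ← Finset.sum_add_distrib]
  · refine Finset.sum_congr rfl fun ij hij => ?_
    rw [lsMap_coeff, lsMap_coeff, hd]; ring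
  · intro a ha
    rw [HahnSeries.mem_support, lsMap_coeff] at ha
    intro h; exact ha (by rw [h, map_zero])
  · intro a ha
    rw [HahnSeries.mem_support, lsMap_coeff] at ha
    intro h; exact ha (by rw [h, map_zero])

lemma lsD_C (a : K) : lsD (HahnSeries.C a : LaurentSeries K) = 0 := by
  ext k
  rw [lsD_coeff, HahnSeries.C_apply, HahnSeries.coeff_single]
  split_ifs with h
  · rw [h]; simp
  · simp

lemma lsD_X : lsD (HahnSeries.single 1 1 : LaurentSeries K) = 1 := by
  ext k
  rw [lsD_coeff, HahnSeries.coeff_single, HahnSeries.coeff_one]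
  by_cases h : k = 0
  · simp [h]
  · simp [h]

lemma lsMap_C (d : K →+ K) (a : K) :
    lsMap d (HahnSeries.C a : LaurentSeries K) = HahnSeries.C (d a) := by
  ext k
  rw [lsMap_coeff, HahnSeries.C_apply, HahnSeries.coeff_single, HahnSeries.C_apply,
    HahnSeries.coeff_single]
  split_ifs <;> simp

lemma lsMap_X (d : K →+ K) (h1 : d 1 = 0) :
    lsMap d (HahnSeries.single 1 1 : LaurentSeries K) = 0 := by
  ext k
  rw [lsMap_coeff, HahnSeries.coeff_single]
  split_ifs <;> simp [h1]

lemma ls_ne (a b : K) (hb : b ≠ 0) :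
    (HahnSeries.C a + HahnSeries.C b * HahnSeries.single 1 1 : LaurentSeries K) ≠ 0 := by
  intro h
  have := congrArg (fun f : LaurentSeries K => f.coeff 1) h
  simp [HahnSeries.C_apply] at this
  exact hb this

/-- Adjoining one outer Laurent variable. -/
noncomputable def ResData.step {n : ℕ} (R : ResData K n) : ResData (LaurentSeries K) (n + 1) where
  x := fun i => Fin.cases (HahnSeries.single 1 1) (fun j => HahnSeries.C (R.x j)) i
  D := fun i => Fin.cases lsD (fun j => lsMap (R.D j)) i
  res :=
    { toFun := fun f => R.res (f.coeff (-1))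
      map_zero' := by simp
      map_add' := by intro f g; simp }
  leib := by
    intro i
    refine Fin.cases ?_ (fun j => ?_) i
    · exact lsD_leib
    · exact lsMap_leib _ (R.leib j)
  Dx := by
    intro i j
    refine Fin.cases ?_ (fun i => ?_) i <;> refine Fin.cases ?_ (fun j => ?_) j
    · simpa using lsD_X
    · simpa using lsD_C _
    · simpa [(Fin.succ_ne_zero _).symm] using lsMap_X _ (R.D_one i)
    · simp only [Fin.cases_succ, lsMap_C, R.Dx, Fin.succ_inj]
      split_ifs <;> simp
  resD := by
    intro i f
    refine Fin.cases ?_ (fun i => ?_) i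
    · change R.res ((lsD f).coeff (-1)) = 0
      rw [lsD_coeff]; simp
    · change R.res ((lsMap (R.D i) f).coeff (-1)) = 0
      rw [lsMap_coeff]; exact R.resD _ _
  x_ne := by
    intro i
    refine Fin.cases ?_ (fun i => ?_) i
    · exact lsX_ne
    · simpa using R.x_ne i
  one_sub_ne := by
    intro i
    refine Fin.cases ?_ (fun i => ?_) i
    · have := ls_ne (1 : K) (-1) (by simp)
      simpa [sub_eq_add_neg] using this
    · simp only [Fin.cases_succ]
      rw [← map_one HahnSeries.C, ← map_sub]
      exact (map_ne_zero HahnSeries.C).2 (R.one_sub_ne i)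
  sub_ne := by
    intro i j h
    revert h
    refine Fin.cases ?_ (fun i => ?_) i <;> refine Fin.cases ?_ (fun j => ?_) j <;> intro h
    · exact absurd rfl h
    · have := ls_ne (R.x j) (-1) (by simp)
      simpa [sub_eq_add_neg] using this
    · have := ls_ne (-R.x i) 1 (by simp)
      simpa [sub_eq_add_neg, add_comm] using this
    · simp only [Fin.cases_succ]
      rw [← map_sub]
      exact (map_ne_zero HahnSeries.C).2 (R.sub_ne i j (by simpa using h))
  one_sub_sub_ne := by
    intro i j h
    revert h
    refine Fin.cases ?_ (fun i => ?_) i <;> refine Fin.cases ?_ (fun j => ?_) j <;> intro h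
    · exact absurd rfl h
    · have := ls_ne (1 - R.x j) (-1) (by simp)
      simpa [sub_eq_add_neg] using this
    · have := ls_ne (1 - R.x i) (-1) (by simp)
      simp only [Fin.cases_succ, Fin.cases_zero]
      convert this using 1
      simp; ring
    · simp only [Fin.cases_succ]
      rw [← map_one HahnSeries.C, ← map_sub, ← map_sub]
      exact (map_ne_zero HahnSeries.C).2 (R.one_sub_sub_ne i j (by simpa using h))

lemma step_res {n : ℕ} (R : ResData K n) (f : LaurentSeries K) :
    R.step.res f = R.res (f.coeff (-1)) := rfl

lemma step_y_zero {n : ℕ} (R : ResData K n) :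
    R.step.y 0 = (HahnSeries.single 1 1 * (1 - HahnSeries.single 1 1) : LaurentSeries K) := rfl

lemma step_y_succ {n : ℕ} (R : ResData K n) (j : Fin n) :
    R.step.y j.succ = (HahnSeries.C (R.y j) : LaurentSeries K) := by
  change (HahnSeries.C (R.x j) * (1 - HahnSeries.C (R.x j)) : LaurentSeries K) = _
  rw [ResData.y, map_mul, map_sub, map_one]

lemma step_V {n : ℕ} (R : ResData K n) :
    R.step.V = (∏ j, (HahnSeries.C (R.y j) - R.step.y 0)) * HahnSeries.C R.V := by
  rw [ResData.V, Fin.prod_univ_succ, Fin.prod_Ioi_zero]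
  simp only [Fin.prod_Ioi_succ, step_y_succ]
  rw [ResData.V, map_prod]
  simp only [map_prod, map_sub]

lemma inv_ofPS (v : PowerSeries K) (hv : PowerSeries.constantCoeff v ≠ 0) :
    (HahnSeries.ofPowerSeries ℤ K v)⁻¹ = HahnSeries.ofPowerSeries ℤ K v⁻¹ := by
  refine inv_eq_of_mul_eq_one_right ?_
  rw [← map_mul, PowerSeries.mul_inv_cancel v hv, map_one]

lemma step_base {n : ℕ} (R : ResData K n) :
    R.step.res (R.step.W * ∏ k, R.step.y k) = R.res R.W := by
  have hP : (∏ k, R.step.y k) ≠ 0 := Finset.prod_ne_zero_iff.2 fun i _ => R.step.y_ne i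
  set u : PowerSeries K := (1 - PowerSeries.X)⁻¹ *
    ∏ j, (PowerSeries.C (R.y j) - PowerSeries.X * (1 - PowerSeries.X))⁻¹ with hu
  have e1 : (1 - HahnSeries.single 1 1 : LaurentSeries K)⁻¹ =
      HahnSeries.ofPowerSeries ℤ K (1 - PowerSeries.X)⁻¹ := by
    rw [← inv_ofPS _ (by simp), map_sub, map_one (HahnSeries.ofPowerSeries ℤ K),
      HahnSeries.ofPowerSeries_X]
  have e2 : ∀ j, (HahnSeries.C (R.y j) - R.step.y 0 : LaurentSeries K)⁻¹ =
      HahnSeries.ofPowerSeries ℤ K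
        (PowerSeries.C (R.y j) - PowerSeries.X * (1 - PowerSeries.X))⁻¹ := by
    intro j
    rw [← inv_ofPS _ (by simpa using R.y_ne j), map_sub, map_mul, map_sub, map_one,
      HahnSeries.ofPowerSeries_X, HahnSeries.ofPowerSeries_C, step_y_zero]
  have e3 : R.step.W * ∏ k, R.step.y k =
      (HahnSeries.single (-1) 1 * HahnSeries.ofPowerSeries ℤ K u) *
        HahnSeries.C ((∏ j, R.y j)⁻¹ * R.V⁻¹) := by
    have : R.step.W * ∏ k, R.step.y k = (∏ k, R.step.y k)⁻¹ * R.step.V⁻¹ := by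
      unfold ResData.W; field_simp
    rw [this, step_V, Fin.prod_univ_succ]
    simp only [step_y_succ]
    rw [← map_prod HahnSeries.C, mul_inv, mul_inv, ← Finset.prod_inv_distrib (f := fun j =>
      (HahnSeries.C (R.y j) - R.step.y 0 : LaurentSeries K))]
    simp only [e2]
    rw [step_y_zero, mul_inv, e1, hu, map_mul, map_mul,
      map_prod (HahnSeries.ofPowerSeries ℤ K), map_inv₀, map_inv₀]
    have : (HahnSeries.single 1 1 : LaurentSeries K)⁻¹ = HahnSeries.single (-1) 1 := by
      refine inv_eq_of_mul_eq_one_right ?_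
      simp
    rw [this]
    ring
  rw [step_res, e3, HahnSeries.C_apply, HahnSeries.coeff_mul_single_zero,
    HahnSeries.coeff_single_mul]
  have e4 : (HahnSeries.ofPowerSeries ℤ K u).coeff (-1 - -1) = ∏ j, (R.y j)⁻¹ := by
    have := HahnSeries.ofPowerSeries_apply_coeff (Γ := ℤ) u 0
    rw [show (-1 - -1 : ℤ) = ((0 : ℕ) : ℤ) by simp, this]
    rw [PowerSeries.coeff_zero_eq_constantCoeff_apply, hu, map_mul, map_prod]
    simp [PowerSeries.constantCoeff_inv]
  rw [e4, Finset.prod_inv_distrib]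
  congr 1
  unfold ResData.W
  ring

end Laurent

/-- The residue data on the iterated Laurent series field. -/
noncomputable def iterData : (n : ℕ) → ResData (IterLS n) n
  | 0 =>
    { x := fun i => i.elim0
      D := fun i => i.elim0
      res := (AddMonoidHom.id ℚ : ℚ →+ ℚ)
      leib := fun i => i.elim0
      Dx := fun i => i.elim0
      resD := fun i => i.elim0
      x_ne := fun i => i.elim0
      one_sub_ne := fun i => i.elim0
      sub_ne := fun i => i.elim0
      one_sub_sub_ne := fun i => i.elim0 }
  | n + 1 => (show ResData (LaurentSeries (IterLS n)) (n + 1) from (iterData n).step)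

lemma iterData_succ (n : ℕ) :
    iterData (n + 1) = (show ResData (LaurentSeries (IterLS n)) (n + 1) from (iterData n).step) :=
  rfl

lemma iterData_x (n : ℕ) : (iterData n).x = IterLS.var n := by
  induction n with
  | zero => funext i; exact i.elim0
  | succ n ih =>
    funext i
    refine Fin.cases ?_ (fun j => ?_) i
    · rfl
    · change (HahnSeries.C ((iterData n).x j) : LaurentSeries (IterLS n)) =
        HahnSeries.C (IterLS.var n j)
      rw [ih]

lemma CT_step {K : Type} [Field K] {n : ℕ} (R : ResData K n) (f : LaurentSeries K) :
    R.step.res (f * (∏ i, R.step.x i)⁻¹) = R.res (f.coeff 0 * (∏ i, R.x i)⁻¹) := by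
  have h : (∏ i, R.step.x i)⁻¹ =
      (HahnSeries.single (-1) (∏ i, R.x i)⁻¹ : LaurentSeries K) := by
    rw [Fin.prod_univ_succ]
    have : ∏ i : Fin n, R.step.x i.succ = (HahnSeries.C (∏ i, R.x i) : LaurentSeries K) := by
      rw [map_prod]; rfl
    rw [this]
    change ((HahnSeries.single 1 1 : LaurentSeries K) * _)⁻¹ = _
    refine inv_eq_of_mul_eq_one_right ?_
    have hP : (∏ k, R.x k) ≠ 0 := Finset.prod_ne_zero_iff.2 fun i _ => R.x_ne i
    rw [HahnSeries.C_apply]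
    simp [HahnSeries.single_mul_single, hP]
  rw [h, step_res, HahnSeries.coeff_mul_single]
  simp

lemma CT_eq (n : ℕ) (F : IterLS n) :
    IterLS.CT n F = (iterData n).res (F * (∏ i, (iterData n).x i)⁻¹) := by
  induction n with
  | zero =>
    have : (∏ i, (iterData 0).x i)⁻¹ = 1 := by simp
    rw [this, mul_one]; rfl
  | succ n ih =>
    have h := CT_step (iterData n) F
    refine Eq.trans ?_ h.symm
    exact ih _

lemma res_W (n : ℕ) : (iterData n).res (iterData n).W = 2 ^ (n ^ 2) *
      ∏ k ∈ Finset.Icc 1 n,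
        ((2 * k).factorial : ℚ) / ((k.factorial : ℚ) * ((k + 1).factorial : ℚ)) := by
  induction n with
  | zero =>
    have : (iterData 0).W = 1 := by simp [ResData.W, ResData.V]
    rw [this]
    simp; rfl
  | succ n ih =>
    have h1 := closed_form n (iterData (n + 1)).c (iterData (n + 1)).c_rec
    rw [ResData.c_n, ResData.c_zero] at h1
    have h2 : (iterData (n + 1)).res ((iterData (n + 1)).W * ∏ k, (iterData (n + 1)).y k) =
      (iterData n).res (iterData n).W := step_base (iterData n)
    rw [h1, h2, ih, Finset.prod_Icc_succ_top (by omega)]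
    ring

/-- **The Mészáros–Morales conjecture** (volume of the `D_n` analog of the
Chan–Robbins–Yuen polytope):
`CT_{x_n} ⋯ CT_{x_1} ∏ x_i⁻¹ (1-x_i)⁻² ∏_{i<j} (x_j-x_i)⁻¹ (1-x_j-x_i)⁻¹
  = 2^{n²} ∏_{k=1}^n Cat(k)`,
where `Cat(k) = (2k)!/(k!(k+1)!)`. -/
theorem meszaros_morales (n : ℕ) (hn : 0 < n) :
    IterLS.CT n
      ((∏ i : Fin n, (IterLS.var n i) ^ (-1 : ℤ) * (1 - IterLS.var n i) ^ (-2 : ℤ)) *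
        ∏ i : Fin n, ∏ j ∈ Finset.Ioi i,
          (IterLS.var n j - IterLS.var n i) ^ (-1 : ℤ) *
            (1 - IterLS.var n j - IterLS.var n i) ^ (-1 : ℤ)) =
    2 ^ (n ^ 2) *
      ∏ k ∈ Finset.Icc 1 n,
        ((2 * k).factorial : ℚ) / ((k.factorial : ℚ) * ((k + 1).factorial : ℚ)) := by
  rw [CT_eq, ← res_W]
  congr 1
  rw [← iterData_x]
  generalize iterData n = R
  unfold ResData.W ResData.V
  simp only [R.y_sub]
  simp only [ResData.y, zpow_neg, zpow_one, Finset.prod_mul_distrib,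
    Finset.prod_inv_distrib, mul_inv]
  rw [show (2 : ℤ) = ((2 : ℕ) : ℤ) by rfl]
  simp only [zpow_natCast, Finset.prod_pow]
  ring
end

section
/- Let n be a positive integer, let a be a positive integer, and let c be a positive half-integer (i.e. m := 2c is a positive integer). Then the iterated constant term CT_{x_n} CT_{x_{n-1}} ⋯ CT_{x_1} of ∏_{i=1}^n x_i^{-(a-1)} (1 - x_i)^{-a} · ∏_{1 ≤ i < j ≤ n} (x_j - x_i)^{-2c} (1 - x_j - x_i)^{-2c} (a rational number) equals, as a real number, 2^{2cn(n-1) + 2(a-1)n} · S_n(a, -1/2, c), where S_n(a,b,c) := (1/n!) ∏_{j=0}^{n-1} Γ(a + b + (n-1+j)c) Γ(c) / ( Γ(a + jc) Γ(c + jc) Γ(b + jc + 1) ). -/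
/-- The Morris–Selberg constant
`S_n(a,b,c) = (1/n!) ∏_{j=0}^{n-1} Γ(a+b+(n-1+j)c) Γ(c) / (Γ(a+jc) Γ(c+jc) Γ(b+jc+1))`. -/
noncomputable def morrisSelberg (n : ℕ) (a b c : ℝ) : ℝ :=
  (1 / (n.factorial : ℝ)) *
    ∏ j ∈ Finset.range n,
      (Real.Gamma (a + b + ((n : ℝ) - 1 + (j : ℝ)) * c) * Real.Gamma c) /
        (Real.Gamma (a + (j : ℝ) * c) * Real.Gamma (c + (j : ℝ) * c) *
          Real.Gamma (b + (j : ℝ) * c + 1))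


noncomputable def IterLS.equivLS (n : ℕ) : IterLS (n+1) ≃+* LaurentSeries (IterLS n) :=
  RingEquiv.refl (LaurentSeries (IterLS n))

theorem IterLS.CT_succ (n : ℕ) (f : IterLS (n+1)) :
    IterLS.CT (n+1) f = IterLS.CT n ((IterLS.equivLS n f).coeff 0) := rfl
theorem IterLS.equiv_var_zero (n : ℕ) :
    IterLS.equivLS n (IterLS.var (n+1) 0) = HahnSeries.single (1 : ℤ) 1 := rfl
theorem IterLS.equiv_var_succ (n : ℕ) (j : Fin n) :
    IterLS.equivLS n (IterLS.var (n+1) j.succ) = HahnSeries.C (IterLS.var n j) := rfl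

theorem IterLS.CT_add : ∀ (n : ℕ) (f g : IterLS n),
    IterLS.CT n (f + g) = IterLS.CT n f + IterLS.CT n g
  | 0, _, _ => rfl
  | n + 1, f, g => by
    rw [CT_succ, CT_succ, CT_succ, map_add, HahnSeries.coeff_add, IterLS.CT_add n]

noncomputable def IterLS.ctHom (n : ℕ) : IterLS n →+ ℚ :=
  AddMonoidHom.mk' (IterLS.CT n) (IterLS.CT_add n)

/-- coefficientwise derivation -/
noncomputable def zA_dser {K : Type} [Field K] (s : ℤ) (d : Derivation ℤ K K)
    (f : LaurentSeries K) : LaurentSeries K where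
  coeff k := (s * k : ℤ) * f.coeff k + d (f.coeff k)
  isPWO_support' := f.isPWO_support.mono (by
    intro k hk hk'
    apply hk
    simp only [hk']; simp)

theorem zA_dser_coeff {K : Type} [Field K] (s : ℤ) (d : Derivation ℤ K K)
    (f : LaurentSeries K) (k : ℤ) :
    (zA_dser s d f).coeff k = (s * k : ℤ) * f.coeff k + d (f.coeff k) := rfl

theorem zA_dser_add {K : Type} [Field K] (s : ℤ) (d : Derivation ℤ K K) (f g : LaurentSeries K) :
    zA_dser s d (f + g) = zA_dser s d f + zA_dser s d g := by
  ext k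
  simp only [zA_dser_coeff, HahnSeries.coeff_add, map_add]; ring

theorem zA_dser_supp {K : Type} [Field K] (s : ℤ) (d : Derivation ℤ K K) (f : LaurentSeries K) :
    (zA_dser s d f).support ⊆ f.support := by
  intro k hk hk'
  apply hk
  simp [zA_dser_coeff, hk']

theorem zA_dser_mul {K : Type} [Field K] (s : ℤ) (d : Derivation ℤ K K) (f g : LaurentSeries K) :
    zA_dser s d (f * g) = f * zA_dser s d g + g * zA_dser s d f := by
  ext k
  rw [mul_comm g, HahnSeries.coeff_add, HahnSeries.coeff_mul_left' f.isPWO_support (zA_dser_supp s d f),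
    HahnSeries.coeff_mul_right' g.isPWO_support (zA_dser_supp s d g), zA_dser_coeff,
    HahnSeries.coeff_mul, map_sum, Finset.mul_sum, ← Finset.sum_add_distrib,
    ← Finset.sum_add_distrib]
  refine Finset.sum_congr rfl fun ij hij => ?_
  have h : ij.1 + ij.2 = k := by
    simpa using (Finset.mem_antidiagonal.1 hij).2.2
  subst h
  simp only [zA_dser_coeff, Derivation.leibniz, smul_eq_mul]
  push_cast; ring

/-- derivation obtained by transporting an additive Leibniz map along an equivalence -/
noncomputable def zA_transport {K L : Type} [Field K] [CommRing L] (e : K ≃+* L) (D : L → L)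
    (hadd : ∀ f g, D (f + g) = D f + D g) (hmul : ∀ f g, D (f * g) = f * D g + g * D f) :
    Derivation ℤ K K :=
  Derivation.mk' (AddMonoidHom.mk' (fun f => e.symm (D (e f)))
    (by intro a b; simp [hadd])).toIntLinearMap (by intro a b; simp [hmul])

theorem zA_transport_apply {K L : Type} [Field K] [CommRing L] (e : K ≃+* L) (D : L → L)
    (hadd : ∀ f g, D (f + g) = D f + D g) (hmul : ∀ f g, D (f * g) = f * D g + g * D f) (f : K) :
    e (zA_transport e D hadd hmul f) = D (e f) := by
  simp [zA_transport]

noncomputable def IterLS.theta : (n : ℕ) → Fin n → Derivation ℤ (IterLS n) (IterLS n)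
  | n + 1, i =>
      Fin.cases (zA_transport (IterLS.equivLS n) (zA_dser 1 0) (zA_dser_add _ _) (zA_dser_mul _ _))
        (fun j => zA_transport (IterLS.equivLS n) (zA_dser 0 (IterLS.theta n j))
          (zA_dser_add _ _) (zA_dser_mul _ _)) i

theorem IterLS.theta_zero (n : ℕ) (f : IterLS (n+1)) :
    IterLS.equivLS n (IterLS.theta (n+1) 0 f) = zA_dser 1 0 (IterLS.equivLS n f) :=
  zA_transport_apply _ _ (zA_dser_add _ _) (zA_dser_mul _ _) f

theorem IterLS.theta_succ (n : ℕ) (j : Fin n) (f : IterLS (n+1)) :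
    IterLS.equivLS n (IterLS.theta (n+1) j.succ f)
      = zA_dser 0 (IterLS.theta n j) (IterLS.equivLS n f) :=
  zA_transport_apply _ _ (zA_dser_add _ _) (zA_dser_mul _ _) f

theorem IterLS.CT_theta : ∀ (n : ℕ) (i : Fin n) (f : IterLS n),
    IterLS.ctHom n (IterLS.theta n i f) = 0
  | n + 1, i, f => by
    change IterLS.CT (n+1) _ = 0
    refine Fin.cases ?_ (fun j => ?_) i
    · rw [CT_succ, theta_zero, zA_dser_coeff]
      have h : IterLS.CT n 0 = 0 := (IterLS.ctHom n).map_zero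
      simpa using h
    · rw [CT_succ, theta_succ, zA_dser_coeff]
      have h : IterLS.CT n (IterLS.theta n j ((IterLS.equivLS n f).coeff 0)) = 0 :=
        IterLS.CT_theta n j _
      simpa using h

theorem IterLS.theta_var : ∀ (n : ℕ) (i j : Fin n),
    IterLS.theta n i (IterLS.var n j) = if i = j then IterLS.var n i else 0
  | n + 1, i, j => by
    apply (IterLS.equivLS n).injective
    refine Fin.cases ?_ (fun i => ?_) i <;> refine Fin.cases ?_ (fun j => ?_) j
    · rw [theta_zero, if_pos rfl, equiv_var_zero]
      ext k
      rw [zA_dser_coeff]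
      by_cases hk : k = 1
      · subst hk; simp
      · simp [HahnSeries.coeff_single_of_ne hk]
    · rw [theta_zero, if_neg (Fin.succ_ne_zero j).symm, equiv_var_succ, map_zero]
      ext k
      rw [zA_dser_coeff]
      by_cases hk : k = 0
      · subst hk; simp
      · simp [HahnSeries.C_apply, HahnSeries.coeff_single_of_ne hk]
    · rw [theta_succ, if_neg (Fin.succ_ne_zero i), equiv_var_zero, map_zero]
      ext k
      rw [zA_dser_coeff]
      by_cases hk : k = 1
      · subst hk; simp
      · simp [HahnSeries.coeff_single_of_ne hk]
    · rw [theta_succ, equiv_var_succ]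
      have := IterLS.theta_var n i j
      ext k
      rw [zA_dser_coeff]
      by_cases hk : k = 0
      · subst hk
        simp only [HahnSeries.C_apply, HahnSeries.coeff_single_same, this, Fin.succ_inj]
        split_ifs
        · rw [equiv_var_succ]; simp [HahnSeries.C_apply]
        · simp
      · simp only [HahnSeries.C_apply, HahnSeries.coeff_single_of_ne hk, Fin.succ_inj]
        split_ifs
        · rw [equiv_var_succ]; simp [HahnSeries.C_apply, HahnSeries.coeff_single_of_ne hk]
        · simp

theorem IterLS.var_ne_zero : ∀ (n : ℕ) (i : Fin n), IterLS.var n i ≠ 0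
  | n + 1, i => by
    intro h
    have h := congrArg (IterLS.equivLS n) h
    revert h
    refine Fin.cases ?_ (fun j => ?_) i
    · rw [equiv_var_zero, map_zero]; simp
    · rw [equiv_var_succ, map_zero]
      exact HahnSeries.C_ne_zero (IterLS.var_ne_zero n j)

theorem IterLS.charZero : ∀ n : ℕ, CharZero (IterLS n)
  | 0 => inferInstanceAs (CharZero ℚ)
  | n + 1 => by
    have := IterLS.charZero n
    exact charZero_of_injective_ringHom
      (f := (IterLS.equivLS n).symm.toRingHom.comp (HahnSeries.C : IterLS n →+* LaurentSeries (IterLS n)))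
      ((IterLS.equivLS n).symm.injective.comp HahnSeries.C_injective)

section ZeilAux
open Polynomial

theorem zA_logd_prod {K ι : Type*} [Field K] (d : Derivation ℤ K K) (s : Finset ι) (f : ι → K)
    (g : ι → K) (h : ∀ i ∈ s, d (f i) = f i * g i) :
    d (∏ i ∈ s, f i) = (∏ i ∈ s, f i) * ∑ i ∈ s, g i := by
  classical
  induction s using Finset.induction_on with
  | empty => simp
  | insert i s hi ih =>
    rw [Finset.prod_insert hi, Finset.sum_insert hi, Derivation.leibniz,
      ih (fun j hj => h j (Finset.mem_insert_of_mem hj)), h i (Finset.mem_insert_self _ _)]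
    simp only [smul_eq_mul]; ring

theorem zA_logd_zpow {K : Type*} [Field K] (d : Derivation ℤ K K) (f : K) (hf : f ≠ 0) (k : ℤ) :
    d (f ^ k) = f ^ k * (k * (d f / f)) := by
  rw [Derivation.leibniz_zpow, zpow_sub_one₀ hf]
  simp only [smul_eq_mul, zsmul_eq_mul]; field_simp

theorem zA_coeff_const {K ι : Type*} [Field K] (d : Derivation ℤ K K) (s : Finset ι) (u : ι → K)
    (h : ∀ i ∈ s, d (u i) = 0) (r : ℕ) : d ((∏ i ∈ s, (X + C (u i))).coeff r) = 0 := by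
  classical
  induction s using Finset.induction_on generalizing r with
  | empty => simp only [Finset.prod_empty, coeff_one]; split_ifs <;> simp
  | insert i s hi ih =>
    have ih' := ih (fun j hj => h j (Finset.mem_insert_of_mem hj))
    rw [Finset.prod_insert hi, add_mul, coeff_add, coeff_C_mul]
    rw [map_add, Derivation.leibniz, ih', h i (Finset.mem_insert_self _ _)]
    cases r with
    | zero => simp
    | succ r => simp [coeff_X_mul, ih']

/-- antisymmetric sum over ordered pairs -/
theorem zA_pairs {K : Type*} [Field K] {n : ℕ} (u v : Fin n → K) (i : Fin n) (V : K)
    (hv : ∀ j, v j = if i = j then V else 0) :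
    ∑ l : Fin n, ∑ j ∈ Finset.Ioi l, (v j - v l) / (u j - u l) = V * ∑ j, (u i - u j)⁻¹ := by
  have h1 : ∀ l, ∑ j ∈ Finset.Ioi l, (v j - v l) / (u j - u l)
      = ∑ j, if l < j then (v j - v l) / (u j - u l) else 0 := by
    intro l
    rw [← Finset.sum_filter]
    congr 1
    ext; simp
  simp only [h1]
  have h2 : ∀ l j, (if l < j then (v j - v l) / (u j - u l) else 0)
      = (if i = j then (if l < i then V * (u i - u l)⁻¹ else 0) else 0)
        + (if i = l then (if i < j then V * (u i - u j)⁻¹ else 0) else 0) := by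
    intro l j
    rw [hv, hv]
    by_cases hij : i = j
    · subst hij
      by_cases hil : i = l
      · subst hil; simp
      · simp [hil, div_eq_mul_inv]
    · by_cases hil : i = l
      · subst hil
        have : (u i - u j) = - (u j - u i) := by ring
        rw [this, inv_neg]
        simp [hij, div_eq_mul_inv]
      · simp [hij, hil]
  simp only [h2, Finset.sum_add_distrib]
  rw [Finset.sum_comm (f := fun l j => if i = l then (if i < j then V * (u i - u j)⁻¹ else 0) else 0)]
  simp only [Finset.sum_ite_eq, Finset.mem_univ, if_true]
  rw [← Finset.sum_add_distrib, Finset.mul_sum]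
  refine Finset.sum_congr rfl fun j _ => ?_
  rcases lt_trichotomy i j with h | h | h
  · simp [h, h.not_gt]
  · subst h; simp
  · simp [h, h.not_gt]

/-- the polynomial identities. -/
theorem zA_poly {K : Type*} [Field K] {n : ℕ} (u : Fin n → K)
    (hu : Function.Injective u) (A B m : K) (P : K[X]) (hP : P = ∏ i, (X + C (u i)))
    (Q : Fin n → K[X]) (hQ : ∀ i, Q i = ∏ l ∈ Finset.univ.erase i, (X + C (u l))) :
    2 * ∑ i, (C (A - B * u i) - C (m * (1 - 4 * u i) * u i * ∑ j, (u i - u j)⁻¹)) * Q i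
     = 2 * C A * derivative P - 2 * C B * ((n : K[X]) * P - X * derivative P)
       - C m * X * derivative (derivative P)
       + 4 * C m * ((n : K[X]) * ((n : K[X]) - 1) * P - X ^ 2 * derivative (derivative P)) := by
  classical
  set R : Fin n → Fin n → K[X] := fun i j =>
    ∏ l ∈ (Finset.univ.erase i).erase j, (X + C (u l)) with hR
  have hPQ : ∀ i, P = (X + C (u i)) * Q i := by
    intro i; rw [hP, hQ, Finset.mul_prod_erase _ (fun l => X + C (u l)) (Finset.mem_univ i)]
  have hQR : ∀ i j, i ≠ j → Q i = (X + C (u j)) * R i j := by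
    intro i j hij
    simp only [hR]
    rw [hQ, Finset.mul_prod_erase _ (fun l => X + C (u l)) (Finset.mem_erase.2 ⟨hij.symm, Finset.mem_univ j⟩)]
  have hRs : ∀ i j, R i j = R j i := by
    intro i j; simp only [hR]; rw [Finset.erase_right_comm]
  have d1 : derivative P = ∑ i, Q i := by
    rw [hP, derivative_prod_finset]
    refine Finset.sum_congr rfl fun i _ => ?_
    rw [hQ]; simp
  have d2 : derivative (derivative P) = ∑ i, ∑ j ∈ Finset.univ.erase i, R i j := by
    rw [d1, derivative_sum]
    refine Finset.sum_congr rfl fun i _ => ?_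
    rw [hQ, derivative_prod_finset]
    refine Finset.sum_congr rfl fun j _ => ?_
    simp [hR]
  have d2' : derivative (derivative P) = ∑ i, ∑ j, if i = j then 0 else R i j := by
    rw [d2]
    refine Finset.sum_congr rfl fun i _ => ?_
    rw [← Finset.sum_erase (s := Finset.univ) (a := i) (f := fun j => if i = j then 0 else R i j) (by simp)]
    refine Finset.sum_congr rfl fun j hj => ?_
    rw [if_neg (Finset.ne_of_mem_erase hj).symm]
  have s1 : ∑ i, C (u i) * Q i = (n : K[X]) * P - X * derivative P := by
    rw [d1, Finset.mul_sum, eq_sub_iff_add_eq, ← Finset.sum_add_distrib]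
    rw [Finset.sum_congr rfl (g := fun _ => P)]
    · simp
    · intro i _; rw [hPQ i]; ring
  -- pair sum
  have s2 : 2 * ∑ i, C ((1 - 4 * u i) * u i * ∑ j, (u i - u j)⁻¹) * Q i
      = X * derivative (derivative P) - 4 * ((n : K[X]) * ((n : K[X]) - 1) * P - X ^ 2 * derivative (derivative P)) := by
    set f : Fin n → Fin n → K[X] := fun i j => C ((1 - 4 * u i) * u i * (u i - u j)⁻¹) * Q i with hf
    have e1 : ∑ i, C ((1 - 4 * u i) * u i * ∑ j, (u i - u j)⁻¹) * Q i = ∑ i, ∑ j, f i j := by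
      refine Finset.sum_congr rfl fun i _ => ?_
      rw [Finset.mul_sum, map_sum, Finset.sum_mul]
    have e2 : 2 * ∑ i, ∑ j, f i j = ∑ i, ∑ j, (f i j + f j i) := by
      simp only [Finset.sum_add_distrib]
      rw [Finset.sum_comm (f := fun i j => f j i), two_mul]
    have e3 : ∀ i j, f i j + f j i = X * (if i = j then 0 else R i j)
        - 4 * ((if i = j then 0 else P) - X ^ 2 * (if i = j then 0 else R i j)) := by
      intro i j
      by_cases hij : i = j
      · subst hij; simp [hf]
      · have hne : u i - u j ≠ 0 := sub_ne_zero.2 (fun h => hij (hu h))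
        have hne' : u j - u i ≠ 0 := sub_ne_zero.2 (fun h => hij (hu h).symm)
        simp only [hf, if_neg hij]
        rw [hPQ i, hQR i j hij, hQR j i (Ne.symm hij), hRs j i]
        have : (u j - u i)⁻¹ = - (u i - u j)⁻¹ := by rw [← inv_neg]; congr 1; ring
        rw [this]
        have hc : C (u i - u j)⁻¹ * (C (u i) - C (u j)) = 1 := by
          rw [← C_sub, ← C_mul, inv_mul_cancel₀ hne, C_1]
        simp only [C_mul, C_neg, C_sub, C_1]
        have h4 : (C (4:K)) = 4 := rfl
        rw [h4]
        linear_combination (R i j * (X - 4 * (C (u i) * X + C (u j) * X + C (u i) * C (u j)))) * hc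
    have e4 : ∑ i : Fin n, ∑ j : Fin n, (if i = j then 0 else P) = n * (n - 1) * P := by
      have : ∀ i j : Fin n, (if i = j then 0 else P) = P - (if i = j then P else 0) := by
        intro i j; split_ifs <;> simp
      simp only [this, Finset.sum_sub_distrib]
      simp
      ring
    rw [e1, e2]
    simp only [e3, Finset.sum_sub_distrib, ← Finset.mul_sum, ← d2', e4]
  have s3 : ∑ i, (C (A - B * u i) - C (m * (1 - 4 * u i) * u i * ∑ j, (u i - u j)⁻¹)) * Q i
      = C A * derivative P - C B * ∑ i, C (u i) * Q i
        - C m * ∑ i, C ((1 - 4 * u i) * u i * ∑ j, (u i - u j)⁻¹) * Q i := by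
    rw [d1, Finset.mul_sum, Finset.mul_sum, Finset.mul_sum, ← Finset.sum_sub_distrib,
      ← Finset.sum_sub_distrib]
    refine Finset.sum_congr rfl fun i _ => ?_
    simp only [C_mul, C_sub]; ring
  rw [s3, s1]
  linear_combination (- C m) * s2


noncomputable def zA_Phi {K : Type} [Field K] {n : ℕ} (u : Fin n → K) (a m : ℕ) : K :=
  (∏ i, (u i) ^ (-(a : ℤ))) * ∏ i, ∏ j ∈ Finset.Ioi i, (u j - u i) ^ (-(m : ℤ))

theorem zA_coeffR {K : Type} [Field K] (n r : ℕ) (A B m : K) (P : K[X]) :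
    (2 * C A * derivative P - 2 * C B * ((n : K[X]) * P - X * derivative P)
       - C m * X * derivative (derivative P)
       + 4 * C m * ((n : K[X]) * ((n : K[X]) - 1) * P - X ^ 2 * derivative (derivative P))).coeff r
    = (r + 1) * (2 * A - m * r) * P.coeff (r + 1)
      + (n - r) * (4 * m * (n + r - 1) - 2 * B) * P.coeff r := by
  have h1 : (derivative P).coeff r = P.coeff (r + 1) * (r + 1) := coeff_derivative P r
  have h2 : (X * derivative P).coeff r = r * P.coeff r := by
    cases r with
    | zero => simp
    | succ r => rw [coeff_X_mul, coeff_derivative]; push_cast; ring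
  have h3 : (X * derivative (derivative P)).coeff r = r * (r + 1) * P.coeff (r + 1) := by
    cases r with
    | zero => simp
    | succ r => rw [coeff_X_mul, coeff_derivative, coeff_derivative]; push_cast; ring
  have h4 : (X ^ 2 * derivative (derivative P)).coeff r = r * (r - 1) * P.coeff r := by
    rcases r with _ | _ | r
    · simp
    · rw [pow_two, mul_assoc]; simp
    · rw [coeff_X_pow_mul, coeff_derivative, coeff_derivative]; push_cast; ring
  have e : (2 * C A * derivative P - 2 * C B * ((n : K[X]) * P - X * derivative P)
       - C m * X * derivative (derivative P)
       + 4 * C m * ((n : K[X]) * ((n : K[X]) - 1) * P - X ^ 2 * derivative (derivative P)))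
      = C (2 * A) * derivative P - C (2 * B) * (C (n : K) * P - X * derivative P)
       - C m * (X * derivative (derivative P))
       + C (4 * m) * (C ((n : K) * (n - 1)) * P - X ^ 2 * derivative (derivative P)) := by
    have t2 : (C (2:K)) = 2 := rfl
    have t4 : (C (4:K)) = 4 := rfl
    have tn : (C (n:K)) = (n : K[X]) := by simp
    simp only [C_mul, C_sub, C_1, t2, t4, tn]; ring
  rw [e]
  simp only [coeff_add, coeff_sub, coeff_C_mul, h1, h2, h3, h4]
  ring

section
variable {K : Type} [Field K] {n : ℕ} (x : Fin n → K)
  (d : Fin n → Derivation ℤ K K)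

theorem zA_du (hd : ∀ i j, d i (x j) = if i = j then x i else 0) (i j : Fin n) :
    d i (x j * (1 - x j)) = if i = j then x i * (1 - 2 * x i) else 0 := by
  rw [Derivation.leibniz, map_sub, hd, Derivation.map_one_eq_zero]
  simp only [smul_eq_mul]
  split_ifs with h
  · subst h; ring
  · ring

theorem zA_ne2 [CharZero K] (hd : ∀ i j, d i (x j) = if i = j then x i else 0) (hx : ∀ i, x i ≠ 0)
    (k : ℤ) (hk : k ≠ 0) (i : Fin n) : 1 - k * x i ≠ 0 := by
  intro h
  have := congrArg (d i) h
  rw [map_sub, Derivation.leibniz, hd, Derivation.map_one_eq_zero, Derivation.map_intCast] at this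
  simp [hk, hx] at this

theorem zA_inj [CharZero K] (hd : ∀ i j, d i (x j) = if i = j then x i else 0) (hx : ∀ i, x i ≠ 0) :
    Function.Injective (fun i => x i * (1 - x i)) := by
  intro i j h
  by_contra hij
  have := congrArg (d i) h
  simp only at this
  rw [zA_du x d hd, zA_du x d hd, if_pos rfl, if_neg hij] at this
  have h2 := zA_ne2 x d hd hx 2 (by norm_num) i
  push_cast at h2
  exact mul_ne_zero (hx i) h2 this

theorem zA_dPhi [CharZero K] (hd : ∀ i j, d i (x j) = if i = j then x i else 0) (hx : ∀ i, x i ≠ 0)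
    (u : Fin n → K) (hu : u = fun i => x i * (1 - x i)) (a m : ℕ) (i : Fin n) :
    d i (zA_Phi u a m) = zA_Phi u a m *
      (- (a : K) * (x i * (1 - 2 * x i)) / u i
        - m * ((x i * (1 - 2 * x i)) * ∑ j, (u i - u j)⁻¹)) := by
  have hinj : Function.Injective u := hu ▸ zA_inj x d hd hx
  have hu0 : ∀ i, u i ≠ 0 := by
    intro i; rw [hu]
    have h2 := zA_ne2 x d hd hx 1 (by norm_num) i
    push_cast at h2
    exact mul_ne_zero (hx i) (by simpa using h2)
  have hdu : ∀ j, d i (u j) = if i = j then x i * (1 - 2 * x i) else 0 := by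
    intro j; rw [hu]; exact zA_du x d hd i j
  have e1 := zA_logd_prod (d i) Finset.univ (fun j => (u j) ^ (-(a : ℤ)))
    (fun j => ((-(a:ℤ) : ℤ) : K) * (d i (u j) / u j)) (fun j _ => zA_logd_zpow _ _ (hu0 j) _)
  have e2 : ∀ l, d i (∏ j ∈ Finset.Ioi l, (u j - u l) ^ (-(m : ℤ))) =
      (∏ j ∈ Finset.Ioi l, (u j - u l) ^ (-(m : ℤ))) *
        ∑ j ∈ Finset.Ioi l, ((-(m:ℤ) : ℤ) : K) * (d i (u j - u l) / (u j - u l)) := by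
    intro l
    apply zA_logd_prod
    intro j hj
    apply zA_logd_zpow
    exact sub_ne_zero.2 (fun h => (Finset.mem_Ioi.1 hj).ne' (hinj h))
  have e3 := zA_logd_prod (d i) Finset.univ _ _ (fun l _ => e2 l)
  have e4 : ∑ l, ∑ j ∈ Finset.Ioi l, ((-(m:ℤ) : ℤ) : K) * (d i (u j - u l) / (u j - u l))
      = - m * ((x i * (1 - 2 * x i)) * ∑ j, (u i - u j)⁻¹) := by
    rw [← zA_pairs u (fun j => d i (u j)) i _ hdu, Finset.mul_sum]
    refine Finset.sum_congr rfl fun l _ => ?_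
    rw [Finset.mul_sum]
    refine Finset.sum_congr rfl fun j _ => ?_
    rw [map_sub]; push_cast; ring
  have e5 : ∑ j, ((-(a:ℤ) : ℤ) : K) * (d i (u j) / u j)
      = - (a : K) * (x i * (1 - 2 * x i)) / u i := by
    rw [Finset.sum_eq_single i]
    · rw [hdu, if_pos rfl]; push_cast; ring
    · intro j _ hj; rw [hdu, if_neg hj.symm]; simp
    · simp
  rw [zA_Phi, Derivation.leibniz, e1, e3, e4, e5]
  simp only [smul_eq_mul]; ring

theorem zA_dy [CharZero K] (hd : ∀ i j, d i (x j) = if i = j then x i else 0) (hx : ∀ i, x i ≠ 0)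
    (u : Fin n → K) (hu : u = fun i => x i * (1 - x i)) (a m : ℕ) (i : Fin n) (q : K)
    (hq : d i q = 0) :
    d i ((∏ l, x l) * ((x i)⁻¹ * ((1 - 2 * x i) * (u i * (q * zA_Phi u a m)))))
     = (∏ l, x l) * zA_Phi u a m * (((1 - (a : K)) - (4 * (1 - a) + 2) * u i
        - m * (1 - 4 * u i) * u i * ∑ j, (u i - u j)⁻¹) * q) := by
  have h1 : d i (∏ l, x l) = ∏ l, x l := by
    rw [zA_logd_prod (d i) Finset.univ x (fun j => if i = j then 1 else 0)]
    · simp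
    · intro j _; rw [hd]; split_ifs with h <;> simp [h]
  have hui : u i = x i * (1 - x i) := by rw [hu]
  have hdu : d i (u i) = x i * (1 - 2 * x i) := by
    rw [hu]; exact (zA_du x d hd i i).trans (if_pos rfl)
  have h2x : d i (1 - 2 * x i) = - 2 * x i := by
    have : (2 : K) = ((2 : ℕ) : K) := by norm_num
    rw [this, map_sub, Derivation.leibniz, Derivation.map_natCast, hd, if_pos rfl,
      Derivation.map_one_eq_zero]
    simp
  have h1x : 1 - x i ≠ 0 := by
    have h2 := zA_ne2 x d hd hx 1 (by norm_num) i
    push_cast at h2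
    simpa using h2
  have hxi := hx i
  simp only [Derivation.leibniz, Derivation.leibniz_inv, h1, h2x, hdu, hq, zA_dPhi x d hd hx u hu,
    smul_eq_mul, hd, if_true]
  generalize ∑ j, (u i - u j)⁻¹ = S
  rw [hui]
  generalize zA_Phi u a m = F
  generalize ∏ l, x l = G
  field_simp
  ring

theorem zA_step [CharZero K] (hd : ∀ i j, d i (x j) = if i = j then x i else 0) (hx : ∀ i, x i ≠ 0)
    (u : Fin n → K) (hu : u = fun i => x i * (1 - x i)) (ct : K →+ ℚ)
    (hct : ∀ i f, ct (d i f) = 0) (a m r : ℕ) (P : K[X]) (hP : P = ∏ i, (X + C (u i))) :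
    ((r : ℚ) + 1) * (2 * ((a : ℚ) - 1) + m * r)
        * ct ((∏ l, x l) * zA_Phi u a m * P.coeff (r + 1))
      = ((n : ℚ) - r) * (4 * m * (n + r - 1) + (8 * ((a : ℚ) - 1) - 4))
        * ct ((∏ l, x l) * zA_Phi u a m * P.coeff r) := by
  classical
  have hinj : Function.Injective u := hu ▸ zA_inj x d hd hx
  set Q : Fin n → K[X] := fun i => ∏ l ∈ Finset.univ.erase i, (X + C (u l)) with hQ
  have key := zA_poly u hinj (1 - (a : K)) (4 * (1 - a) + 2) m P hP Q (fun i => rfl)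
  have key2 := congrArg (fun p => (∏ l, x l) * zA_Phi u a m * p.coeff r) key
  rw [zA_coeffR] at key2
  have hz : ∀ i, ct ((∏ l, x l) * zA_Phi u a m * (((1 - (a : K)) - (4 * (1 - a) + 2) * u i
        - m * (1 - 4 * u i) * u i * ∑ j, (u i - u j)⁻¹) * (Q i).coeff r)) = 0 := by
    intro i
    rw [← zA_dy x d hd hx u hu a m i ((Q i).coeff r), hct]
    apply zA_coeff_const
    intro l hl
    rw [hu]; exact (zA_du x d hd i l).trans (if_neg (Finset.ne_of_mem_erase hl).symm)
  have hs : (∏ l, x l) * zA_Phi u a m * (2 * ∑ i, (C ((1 - (a : K)) - (4 * (1 - a) + 2) * u i)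
      - C (m * (1 - 4 * u i) * u i * ∑ j, (u i - u j)⁻¹)) * Q i : K[X]).coeff r
      = (2 : ℤ) • ∑ i, ((∏ l, x l) * zA_Phi u a m * (((1 - (a : K)) - (4 * (1 - a) + 2) * u i
        - m * (1 - 4 * u i) * u i * ∑ j, (u i - u j)⁻¹) * (Q i).coeff r)) := by
    have t2 : (C (2:K)) = 2 := rfl
    rw [← t2, coeff_C_mul, finsetSum_coeff, ← Finset.mul_sum, zsmul_eq_mul]
    simp only [← C_sub, coeff_C_mul]
    push_cast; ring
  rw [hs] at key2
  have key3 := congrArg ct key2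
  rw [map_zsmul, map_sum, Finset.sum_eq_zero (fun i _ => hz i), smul_zero] at key3
  have hr : (∏ l, x l) * zA_Phi u a m * (((r : K) + 1) * (2 * (1 - (a : K)) - m * r) * P.coeff (r + 1)
      + ((n : K) - r) * (4 * m * (n + r - 1) - 2 * (4 * (1 - a) + 2)) * P.coeff r)
    = (((r : ℤ) + 1) * (2 * (1 - (a : ℤ)) - m * r)) • ((∏ l, x l) * zA_Phi u a m * P.coeff (r + 1))
      + (((n : ℤ) - r) * (4 * m * (n + r - 1) - 2 * (4 * (1 - a) + 2))) •
        ((∏ l, x l) * zA_Phi u a m * P.coeff r) := by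
    simp only [zsmul_eq_mul]; push_cast; ring
  rw [hr, map_add, map_zsmul, map_zsmul] at key3
  simp only [zsmul_eq_mul] at key3
  push_cast at key3
  linear_combination key3

end

theorem zA_step_prod {K : Type} [Field K] [CharZero K] {n : ℕ} (x : Fin n → K)
    (d : Fin n → Derivation ℤ K K) (hd : ∀ i j, d i (x j) = if i = j then x i else 0)
    (hx : ∀ i, x i ≠ 0)
    (u : Fin n → K) (hu : u = fun i => x i * (1 - x i)) (ct : K →+ ℚ)
    (hct : ∀ i f, ct (d i f) = 0) (a m : ℕ) :
    (∏ r ∈ Finset.range n, (2 * (a : ℚ) + m * r)) * ct ((∏ l, x l) * zA_Phi u (a + 1) m)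
      = (∏ r ∈ Finset.range n, (4 * m * ((n : ℚ) + r - 1) + (8 * (a : ℚ) - 4)))
        * ct ((∏ l, x l) * zA_Phi u a m) := by
  set P : K[X] := ∏ i, (X + C (u i)) with hP
  have hu0 : ∀ i, u i ≠ 0 := by
    intro i; rw [hu]
    have h2 := zA_ne2 x d hd hx 1 (by norm_num) i
    push_cast at h2
    exact mul_ne_zero (hx i) (by simpa using h2)
  have hmonic : P.Monic := monic_prod_of_monic _ _ (fun i _ => monic_X_add_C _)
  have hdeg : P.natDegree = n := by
    rw [hP, natDegree_prod_of_monic _ _ (fun i _ => monic_X_add_C _)]; simp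
  have hn : P.coeff n = 1 := by
    have := hmonic.coeff_natDegree; rwa [hdeg] at this
  have h0 : P.coeff 0 = ∏ i, u i := by
    rw [hP, coeff_zero_prod]; simp
  have hPhi : zA_Phi u (a + 1) m * ∏ i, u i = zA_Phi u a m := by
    rw [zA_Phi, zA_Phi, mul_right_comm, ← Finset.prod_mul_distrib]
    congr 1
    refine Finset.prod_congr rfl fun i _ => ?_
    rw [← zpow_add_one₀ (hu0 i)]
    congr 1; push_cast; ring
  have step := zA_step x d hd hx u hu ct hct (a + 1) m (P := P) (hP := hP)
  have gen : ∀ k ≤ n, (∏ r ∈ Finset.range k, (((r : ℚ) + 1) * (2 * (a : ℚ) + m * r)))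
      * ct ((∏ l, x l) * zA_Phi u (a + 1) m * P.coeff k)
      = (∏ r ∈ Finset.range k, (((n : ℚ) - r) * (4 * m * ((n : ℚ) + r - 1) + (8 * (a : ℚ) - 4))))
        * ct ((∏ l, x l) * zA_Phi u (a + 1) m * P.coeff 0) := by
    intro k
    induction k with
    | zero => simp
    | succ k ih =>
      intro hk
      rw [Finset.prod_range_succ, Finset.prod_range_succ]
      have := step k
      push_cast at this
      rw [add_sub_cancel_right] at this
      have ih := ih (by omega)
      linear_combination (∏ r ∈ Finset.range k, (((r : ℚ) + 1) * (2 * (a : ℚ) + m * r))) * this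
        + (((n : ℚ) - k) * (4 * m * ((n : ℚ) + k - 1) + (8 * (a : ℚ) - 4))) * ih
  have g := gen n le_rfl
  rw [hn, mul_one, h0, mul_assoc _ _ (∏ i, u i), hPhi, Finset.prod_mul_distrib,
    Finset.prod_mul_distrib] at g
  have hf : ∏ r ∈ Finset.range n, ((n : ℚ) - r) = ∏ r ∈ Finset.range n, ((r : ℚ) + 1) := by
    rw [← Finset.prod_range_reflect]
    refine Finset.prod_congr rfl fun r hr => ?_
    have := Finset.mem_range.1 hr
    rw [Nat.sub_sub, Nat.cast_sub (by omega)]; push_cast; ring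
  have hf0 : ∏ r ∈ Finset.range n, ((r : ℚ) + 1) ≠ 0 :=
    Finset.prod_ne_zero_iff.2 fun r _ => by positivity
  rw [hf, mul_assoc, mul_assoc] at g
  exact mul_left_cancel₀ hf0 g

end ZeilAux

noncomputable def IterLS.U (n : ℕ) (i : Fin n) : IterLS n := IterLS.var n i * (1 - IterLS.var n i)

noncomputable def IterLS.M (n a m : ℕ) : ℚ :=
  IterLS.CT n ((∏ i, IterLS.var n i) * zA_Phi (IterLS.U n) a m)

theorem IterLS.U_ne_zero (n : ℕ) (i : Fin n) : IterLS.U n i ≠ 0 := by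
  have := IterLS.charZero n
  have h2 := zA_ne2 (IterLS.var n) (IterLS.theta n) (IterLS.theta_var n) (IterLS.var_ne_zero n)
    1 (by norm_num) i
  push_cast at h2
  exact mul_ne_zero (IterLS.var_ne_zero n i) (by simpa using h2)

theorem IterLS.U_inj (n : ℕ) : Function.Injective (IterLS.U n) := by
  have := IterLS.charZero n
  exact zA_inj (IterLS.var n) (IterLS.theta n) (IterLS.theta_var n) (IterLS.var_ne_zero n)

theorem IterLS.M_step (n a m : ℕ) :
    (∏ r ∈ Finset.range n, (2 * (a : ℚ) + m * r)) * IterLS.M n (a + 1) m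
      = (∏ r ∈ Finset.range n, (4 * m * ((n : ℚ) + r - 1) + (8 * (a : ℚ) - 4)))
        * IterLS.M n a m := by
  have := IterLS.charZero n
  exact zA_step_prod (IterLS.var n) (IterLS.theta n) (IterLS.theta_var n) (IterLS.var_ne_zero n)
    (IterLS.U n) rfl (IterLS.ctHom n) (IterLS.CT_theta n) a m

theorem IterLS.M_zero (a m : ℕ) : IterLS.M 0 a m = 1 := by
  have : ((∏ i, IterLS.var 0 i) * zA_Phi (IterLS.U 0) a m) = 1 := by simp [zA_Phi]
  rw [IterLS.M, this]; rfl

noncomputable def IterLS.iota (n : ℕ) : IterLS n →+* IterLS (n + 1) :=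
  (IterLS.equivLS n).symm.toRingHom.comp (HahnSeries.C : IterLS n →+* LaurentSeries (IterLS n))

theorem IterLS.equiv_iota (n : ℕ) (k : IterLS n) :
    IterLS.equivLS n (IterLS.iota n k) = HahnSeries.C k := by simp [IterLS.iota]

theorem IterLS.var_succ (n : ℕ) (j : Fin n) :
    IterLS.var (n + 1) j.succ = IterLS.iota n (IterLS.var n j) := rfl

theorem IterLS.U_succ (n : ℕ) (j : Fin n) :
    IterLS.U (n + 1) j.succ = IterLS.iota n (IterLS.U n j) := by
  simp [IterLS.U, IterLS.var_succ]

theorem zA_coeff_div {K : Type} [Field K] (f : LaurentSeries K) (Q : PowerSeries K) (k : K)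
    (hQ : PowerSeries.constantCoeff Q ≠ 0)
    (h : f * HahnSeries.ofPowerSeries ℤ K Q = HahnSeries.C k) :
    f.coeff 0 = k * (PowerSeries.constantCoeff Q)⁻¹ := by
  have h1 : Q * Q⁻¹ = 1 := PowerSeries.mul_inv_cancel Q hQ
  have h2 : f = HahnSeries.ofPowerSeries ℤ K (PowerSeries.C k * Q⁻¹) := by
    rw [map_mul, HahnSeries.ofPowerSeries_C, ← h, mul_assoc, ← map_mul, h1, map_one, mul_one]
  have h3 := LaurentSeries.coeff_coe_powerSeries (PowerSeries.C k * Q⁻¹) 0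
  rw [h2]
  refine Eq.trans (by simp) (h3.trans ?_)
  simp

theorem IterLS.M_one (n m : ℕ) : IterLS.M (n + 1) 1 m = IterLS.M n (m + 1) m := by
  have hx0 : IterLS.var (n+1) 0 ≠ 0 := IterLS.var_ne_zero _ _
  have hU0 : IterLS.U (n+1) 0 ≠ 0 := IterLS.U_ne_zero _ _
  set x0 := IterLS.var (n+1) 0 with hx0d
  set E : IterLS n := ∏ i, ∏ j ∈ Finset.Ioi i, (IterLS.U n j - IterLS.U n i) ^ (-(m : ℤ)) with hE
  set k : IterLS n := (∏ i, IterLS.var n i) * (∏ i, (IterLS.U n i) ^ (-(1 : ℤ))) * E with hk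
  set q : IterLS (n+1) := (1 - x0) * ∏ j, (IterLS.iota n (IterLS.U n j) - x0 * (1 - x0)) ^ m with hq
  have h1x : 1 - x0 ≠ 0 := right_ne_zero_of_mul hU0
  have hne : ∀ j, IterLS.iota n (IterLS.U n j) - x0 * (1 - x0) ≠ 0 := by
    intro j
    rw [← IterLS.U_succ]
    exact sub_ne_zero.2 (fun h => Fin.succ_ne_zero j (IterLS.U_inj (n+1) h))
  have hfq : ((∏ i, IterLS.var (n+1) i) * zA_Phi (IterLS.U (n+1)) 1 m) * q = IterLS.iota n k := by
    have hD : (∏ j, (IterLS.iota n (IterLS.U n j) - x0 * (1 - x0)) ^ (-(m : ℤ))) *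
        ∏ j, (IterLS.iota n (IterLS.U n j) - x0 * (1 - x0)) ^ m = 1 := by
      rw [← Finset.prod_mul_distrib]
      apply Finset.prod_eq_one
      intro j _
      rw [zpow_neg, zpow_natCast, inv_mul_cancel₀ (pow_ne_zero _ (hne j))]
    have hUU : IterLS.U (n+1) 0 = x0 * (1 - x0) := rfl
    rw [zA_Phi, Fin.prod_univ_succ, Fin.prod_univ_succ, Fin.prod_univ_succ, Fin.prod_Ioi_zero]
    simp only [Fin.prod_Ioi_succ, IterLS.U_succ, IterLS.var_succ, hUU]
    rw [hk, hE, hq]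
    simp only [map_mul, map_prod, map_zpow₀, map_sub]
    rw [← hx0d]
    have hx1 : x0 * (x0 * (1 - x0)) ^ (-((1 : ℕ) : ℤ)) * (1 - x0) = 1 := by
      rw [Nat.cast_one, zpow_neg_one]; field_simp
    rw [Nat.cast_one] at hx1 ⊢
    generalize (∏ j, (IterLS.iota n (IterLS.U n j) - x0 * (1 - x0)) ^ (-(m : ℤ))) = D1 at *
    generalize (∏ j, (IterLS.iota n (IterLS.U n j) - x0 * (1 - x0)) ^ m) = D2 at *
    generalize (x0 * (1 - x0)) ^ (-(1 : ℤ)) = W at *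
    generalize (∏ i, IterLS.iota n (IterLS.var n i)) = A1
    generalize (∏ i, IterLS.iota n (IterLS.U n i) ^ (-(1 : ℤ))) = A2
    generalize (∏ i, ∏ j ∈ Finset.Ioi i, (IterLS.iota n (IterLS.U n j) - IterLS.iota n (IterLS.U n i)) ^ (-(m : ℤ))) = A3
    linear_combination (A1 * A2 * A3 * (x0 * W * (1 - x0))) * hD + (A1 * A2 * A3) * hx1
  have hfq' := congrArg (IterLS.equivLS n) hfq
  rw [map_mul, IterLS.equiv_iota] at hfq'
  set Q : PowerSeries (IterLS n) := (1 - PowerSeries.X) *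
    ∏ j, (PowerSeries.C (IterLS.U n j) - PowerSeries.X * (1 - PowerSeries.X)) ^ m with hQ
  have heq : IterLS.equivLS n q = HahnSeries.ofPowerSeries ℤ (IterLS n) Q := by
    rw [hq, hQ]
    simp only [map_mul, map_prod, map_pow, map_sub, map_one, IterLS.equiv_iota,
      HahnSeries.ofPowerSeries_C, HahnSeries.ofPowerSeries_X, hx0d, IterLS.equiv_var_zero]
  have hc : PowerSeries.constantCoeff Q = ∏ j, IterLS.U n j ^ m := by
    rw [hQ]; simp
  have hc0 : PowerSeries.constantCoeff Q ≠ 0 := by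
    rw [hc]; exact Finset.prod_ne_zero_iff.2 fun j _ => pow_ne_zero _ (IterLS.U_ne_zero n j)
  rw [heq] at hfq'
  have := zA_coeff_div _ Q k hc0 hfq'
  rw [IterLS.M, IterLS.CT_succ, this, IterLS.M]
  congr 1
  rw [hc, hk, hE, zA_Phi, ← Finset.prod_inv_distrib]
  have : ∏ i, IterLS.U n i ^ (-((m + 1 : ℕ) : ℤ))
      = (∏ i, (IterLS.U n i) ^ (-(1 : ℤ))) * ∏ i, (IterLS.U n i ^ m)⁻¹ := by
    rw [← Finset.prod_mul_distrib]
    refine Finset.prod_congr rfl fun i _ => ?_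
    rw [← zpow_natCast, ← zpow_neg, ← zpow_add₀ (IterLS.U_ne_zero n i)]
    congr 1; push_cast; ring
  rw [this]; ring

theorem IterLS.M_eq (n a m : ℕ) :
    IterLS.CT n
      ((∏ i : Fin n,
          (IterLS.var n i) ^ (-((a : ℤ) - 1)) * (1 - IterLS.var n i) ^ (-(a : ℤ))) *
        ∏ i : Fin n, ∏ j ∈ Finset.Ioi i,
          (IterLS.var n j - IterLS.var n i) ^ (-(m : ℤ)) *
            (1 - IterLS.var n j - IterLS.var n i) ^ (-(m : ℤ))) = IterLS.M n a m := by
  rw [IterLS.M, zA_Phi, ← mul_assoc]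
  refine congrArg (IterLS.CT n) (congrArg₂ (· * ·) ?_ ?_)
  · rw [← Finset.prod_mul_distrib (f := IterLS.var n)]
    refine Finset.prod_congr rfl fun i _ => ?_
    rw [IterLS.U, mul_zpow, ← mul_assoc, ← zpow_one_add₀ (IterLS.var_ne_zero n i)]
    congr 2; ring
  · refine Finset.prod_congr rfl fun i _ => Finset.prod_congr rfl fun j _ => ?_
    rw [← mul_zpow, IterLS.U, IterLS.U]
    congr 1; ring

noncomputable def zA_R (n : ℕ) (a c : ℝ) : ℝ :=
  (2 : ℝ) ^ (2 * c * (n : ℝ) * ((n : ℝ) - 1) + 2 * (a - 1) * (n : ℝ)) *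
      morrisSelberg n a (-(1 / 2)) c

theorem zA_R_zero (a c : ℝ) : zA_R 0 a c = 1 := by
  simp [zA_R, morrisSelberg]

theorem zA_R_step (n : ℕ) (a c : ℝ) (hc : 0 < c) (ha : 1 ≤ a) :
    (∏ r ∈ Finset.range n, (2 * a + 2 * c * r)) * zA_R n (a + 1) c
      = (∏ r ∈ Finset.range n, (4 * (2 * c) * ((n : ℝ) + r - 1) + (8 * a - 4))) * zA_R n a c := by
  have hp : (2 : ℝ) ^ (2 * c * (n : ℝ) * ((n : ℝ) - 1) + 2 * (a + 1 - 1) * (n : ℝ))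
      = (2 : ℝ) ^ (2 * c * (n : ℝ) * ((n : ℝ) - 1) + 2 * (a - 1) * (n : ℝ)) *
        ∏ r ∈ Finset.range n, (4 : ℝ) := by
    rw [Finset.prod_const, Finset.card_range,
      show 2 * c * (n : ℝ) * ((n : ℝ) - 1) + 2 * (a + 1 - 1) * (n : ℝ)
        = (2 * c * (n : ℝ) * ((n : ℝ) - 1) + 2 * (a - 1) * (n : ℝ)) + ((2 * n : ℕ) : ℝ) by
          push_cast; ring, Real.rpow_add (by norm_num), Real.rpow_natCast, pow_mul]
    norm_num
  rw [zA_R, zA_R, hp, morrisSelberg, morrisSelberg]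
  have key : (∏ r ∈ Finset.range n, (2 * a + 2 * c * r)) * (∏ r ∈ Finset.range n, (4 : ℝ)) *
      ∏ j ∈ Finset.range n,
      (Real.Gamma (a + 1 + -(1/2) + ((n : ℝ) - 1 + (j : ℝ)) * c) * Real.Gamma c) /
        (Real.Gamma (a + 1 + (j : ℝ) * c) * Real.Gamma (c + (j : ℝ) * c) *
          Real.Gamma (-(1/2) + (j : ℝ) * c + 1))
      = (∏ r ∈ Finset.range n, (4 * (2 * c) * ((n : ℝ) + r - 1) + (8 * a - 4))) *
      ∏ j ∈ Finset.range n,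
      (Real.Gamma (a + -(1/2) + ((n : ℝ) - 1 + (j : ℝ)) * c) * Real.Gamma c) /
        (Real.Gamma (a + (j : ℝ) * c) * Real.Gamma (c + (j : ℝ) * c) *
          Real.Gamma (-(1/2) + (j : ℝ) * c + 1)) := by
    rw [← Finset.prod_mul_distrib, ← Finset.prod_mul_distrib, ← Finset.prod_mul_distrib]
    refine Finset.prod_congr rfl fun j hj => ?_
    have hn : (1 : ℝ) ≤ n := by
      have := Finset.mem_range.1 hj
      exact_mod_cast (by omega : 1 ≤ n)
    have hjc : 0 ≤ (j : ℝ) * c := by positivity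
    have hnc : 0 ≤ ((n : ℝ) - 1 + j) * c := by
      apply mul_nonneg _ hc.le
      have : (0 : ℝ) ≤ j := by positivity
      linarith
    rw [show a + 1 + -(1/2) + ((n : ℝ) - 1 + (j : ℝ)) * c
        = (a + -(1/2) + ((n : ℝ) - 1 + (j : ℝ)) * c) + 1 by ring,
      show a + 1 + (j : ℝ) * c = (a + (j : ℝ) * c) + 1 by ring,
      Real.Gamma_add_one (by linarith), Real.Gamma_add_one (by linarith)]
    have g1 := (Real.Gamma_pos_of_pos (s := a + (j : ℝ) * c) (by linarith)).ne'
    have g2 := (Real.Gamma_pos_of_pos (s := c + (j : ℝ) * c) (by linarith)).ne'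
    have g3 := (Real.Gamma_pos_of_pos (s := -(1/2) + (j : ℝ) * c + 1) (by linarith)).ne'
    have g4 : a + (j : ℝ) * c ≠ 0 := by linarith
    generalize Real.Gamma (a + (j : ℝ) * c) = G1 at *
    generalize Real.Gamma (c + (j : ℝ) * c) = G2 at *
    generalize Real.Gamma (-(1/2) + (j : ℝ) * c + 1) = G3 at *
    generalize Real.Gamma (a + -(1/2) + ((n : ℝ) - 1 + (j : ℝ)) * c) = G5 at *
    field_simp
    ring
  generalize (2 : ℝ) ^ (2 * c * (n : ℝ) * ((n : ℝ) - 1) + 2 * (a - 1) * (n : ℝ)) = T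
  linear_combination (T * (1 / (n.factorial : ℝ))) * key

theorem zA_R_one (n : ℕ) (c : ℝ) (hc : 0 < c) :
    zA_R (n + 1) 1 c = zA_R n (2 * c + 1) c := by
  rw [zA_R, zA_R, morrisSelberg, morrisSelberg]
  congr 1
  · congr 1; push_cast; ring
  have hG : ∀ s : ℝ, 0 < s → Real.Gamma s ≠ 0 := fun s hs => (Real.Gamma_pos_of_pos hs).ne'
  have hj : ∀ j : ℕ, 0 ≤ (j : ℝ) * c := fun j => by positivity
  simp only [Finset.prod_div_distrib, Finset.prod_mul_distrib]
  have p1 : ∏ j ∈ Finset.range (n + 1), Real.Gamma (1 + -(1/2) + (((n + 1 : ℕ) : ℝ) - 1 + (j : ℝ)) * c)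
      = Real.Gamma (1/2 + n * c) *
        ∏ j ∈ Finset.range n, Real.Gamma (2 * c + 1 + -(1/2) + ((n : ℝ) - 1 + (j : ℝ)) * c) := by
    rw [Finset.prod_range_succ', mul_comm]
    congr 1
    · congr 1; push_cast; ring
    · refine Finset.prod_congr rfl fun j _ => ?_
      congr 1; push_cast; ring
  have p2 : ∏ j ∈ Finset.range (n + 1), Real.Gamma (-(1/2) + (j : ℝ) * c + 1)
      = (∏ j ∈ Finset.range n, Real.Gamma (-(1/2) + (j : ℝ) * c + 1)) * Real.Gamma (1/2 + n * c) := by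
    rw [Finset.prod_range_succ]
    congr 2; ring
  have p3 : (∏ j ∈ Finset.range (n + 1), Real.Gamma (1 + (j : ℝ) * c)) *
        Real.Gamma (1 + (n + 1) * c)
      = Real.Gamma (1 + c) * ∏ j ∈ Finset.range n, Real.Gamma (2 * c + 1 + (j : ℝ) * c) := by
    have : (∏ j ∈ Finset.range (n + 1), Real.Gamma (1 + (j : ℝ) * c)) *
        Real.Gamma (1 + (n + 1) * c) = ∏ j ∈ Finset.range (n + 2), Real.Gamma (1 + (j : ℝ) * c) := by
      rw [Finset.prod_range_succ _ (n + 1)]; push_cast; rfl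
    rw [this, Finset.prod_range_succ', Finset.prod_range_succ']
    have h0 : Real.Gamma (1 + ((0 : ℕ) : ℝ) * c) = 1 := by simp
    rw [h0, mul_one, mul_comm]
    congr 1
    · congr 1; push_cast; ring
    · refine Finset.prod_congr rfl fun j _ => ?_
      congr 1; push_cast; ring
  rw [p1, p2, Finset.prod_range_succ (fun j : ℕ => Real.Gamma (c + (j : ℝ) * c)),
    Finset.prod_range_succ (fun j : ℕ => Real.Gamma c), Nat.factorial_succ]
  have q1 : Real.Gamma (1 + ((n : ℝ) + 1) * c) = ((n : ℝ) + 1) * c * Real.Gamma (c + n * c) := by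
    rw [show 1 + ((n : ℝ) + 1) * c = ((n : ℝ) + 1) * c + 1 by ring, Real.Gamma_add_one (by positivity)]
    congr 2; ring
  have q2 : Real.Gamma (1 + c) = c * Real.Gamma c := by
    rw [add_comm, Real.Gamma_add_one hc.ne']
  rw [q1, q2] at p3
  have n1 : ∏ j ∈ Finset.range (n + 1), Real.Gamma (1 + (j : ℝ) * c) ≠ 0 :=
    Finset.prod_ne_zero_iff.2 fun j _ => hG _ (by linarith [hj j])
  have n2 : ∏ j ∈ Finset.range n, Real.Gamma (2 * c + 1 + (j : ℝ) * c) ≠ 0 :=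
    Finset.prod_ne_zero_iff.2 fun j _ => hG _ (by linarith [hj j])
  have n3 : ∏ j ∈ Finset.range n, Real.Gamma (c + (j : ℝ) * c) ≠ 0 :=
    Finset.prod_ne_zero_iff.2 fun j _ => hG _ (by linarith [hj j])
  have n4 : ∏ j ∈ Finset.range n, Real.Gamma (-(1/2) + (j : ℝ) * c + 1) ≠ 0 :=
    Finset.prod_ne_zero_iff.2 fun j _ => hG _ (by linarith [hj j])
  have n5 := hG (1/2 + n * c) (by linarith [hj n])
  have n6 := hG (c + n * c) (by linarith [hj n])
  have n7 := hG c hc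
  have n8 : (n.factorial : ℝ) ≠ 0 := by positivity
  generalize ∏ j ∈ Finset.range (n + 1), Real.Gamma (1 + (j : ℝ) * c) = A1 at *
  generalize ∏ j ∈ Finset.range n, Real.Gamma (2 * c + 1 + (j : ℝ) * c) = A2 at *
  generalize ∏ j ∈ Finset.range n, Real.Gamma (c + (j : ℝ) * c) = A3 at *
  generalize ∏ j ∈ Finset.range n, Real.Gamma (-(1/2) + (j : ℝ) * c + 1) = A4 at *
  generalize Real.Gamma (1/2 + n * c) = A5 at *
  generalize Real.Gamma (c + n * c) = A6 at *
  generalize Real.Gamma c = A7 at *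
  generalize ∏ j ∈ Finset.range n, Real.Gamma (2 * c + 1 + -(1/2) + ((n : ℝ) - 1 + (j : ℝ)) * c) = A8
  have p3' : A1 * ((n + 1) * A6) = A7 * A2 := by
    apply mul_left_cancel₀ hc.ne'
    linear_combination p3
  have hA : A2 = A1 * ((n + 1) * A6) / A7 := by rw [p3']; field_simp
  rw [hA]
  push_cast
  have : (n : ℝ) + 1 ≠ 0 := by positivity
  generalize (n.factorial : ℝ) = F at *
  field_simp

theorem zA_main (m : ℕ) (hm : 0 < m) (c : ℝ) (hmc : (m : ℝ) = 2 * c) :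
    ∀ n a : ℕ, ((IterLS.M n (a + 1) m : ℚ) : ℝ) = zA_R n ((a : ℝ) + 1) c := by
  have hc : 0 < c := by
    have : (0 : ℝ) < m := by exact_mod_cast hm
    linarith
  intro n
  induction n with
  | zero => intro a; rw [IterLS.M_zero, zA_R_zero]; simp
  | succ n ih =>
    intro a
    induction a with
    | zero =>
      rw [zero_add, IterLS.M_one, ih, Nat.cast_zero, zero_add, zA_R_one n c hc, hmc]
    | succ a iha =>
      have h1 := congrArg (fun q : ℚ => (q : ℝ)) (IterLS.M_step (n + 1) (a + 1) m)
      have h2 := zA_R_step (n + 1) ((a : ℝ) + 1) c hc (by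
        have : (0 : ℝ) ≤ a := by positivity
        linarith)
      push_cast at h1 h2 ⊢
      rw [iha, hmc, ← h2] at h1
      refine mul_left_cancel₀ (Finset.prod_ne_zero_iff.2 fun r _ => ?_) h1
      positivity

/-- **Zeilberger's Fact**: for a positive integer `a` and a positive half-integer
`c` (with `m := 2c` a positive integer),
`CT_{x_n} ⋯ CT_{x_1} ∏ x_i^{-(a-1)} (1-x_i)^{-a} ∏_{i<j} (x_j-x_i)^{-2c} (1-x_j-x_i)^{-2c}
  = 2^{2cn(n-1)+2(a-1)n} · S_n(a, -1/2, c)`. -/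
theorem zeilberger_fact (n : ℕ) (hn : 0 < n) (a : ℕ) (ha : 0 < a) (c : ℝ) (m : ℕ)
    (hm : 0 < m) (hmc : (m : ℝ) = 2 * c) :
    ((IterLS.CT n
      ((∏ i : Fin n,
          (IterLS.var n i) ^ (-((a : ℤ) - 1)) * (1 - IterLS.var n i) ^ (-(a : ℤ))) *
        ∏ i : Fin n, ∏ j ∈ Finset.Ioi i,
          (IterLS.var n j - IterLS.var n i) ^ (-(m : ℤ)) *
            (1 - IterLS.var n j - IterLS.var n i) ^ (-(m : ℤ))) : ℚ) : ℝ) =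
    (2 : ℝ) ^ (2 * c * (n : ℝ) * ((n : ℝ) - 1) + 2 * ((a : ℝ) - 1) * (n : ℝ)) *
      morrisSelberg n (a : ℝ) (-(1 / 2)) c := by
  obtain ⟨b, rfl⟩ : ∃ b, a = b + 1 := ⟨a - 1, by omega⟩
  rw [IterLS.M_eq, zA_main m hm c hmc n b, zA_R]
  push_cast
  rfl
end

section
/- Let n, a, m be positive integers with b a nonnegative integer, write c := m/2, and let r_1, …, r_n be real radii with 0 < r_1 < r_2 < ⋯ < r_n < 1. Then the iterated complex contour integral (1/(2πi))^n ∮_{|x_n| = r_n} ⋯ ∮_{|x_1| = r_1} ∏_{i=1}^{n} (1 - x_i)^{-a} · ∏_{i=1}^{n} x_i^{-b-1} · ∏_{1 ≤ i < j ≤ n} (x_j - x_i)^{-m} dx_1 ⋯ dx_n, where each circle is traversed once counterclockwise, equals S_n(a, b, c) := (1/n!) ∏_{j=0}^{n-1} Γ(a + b + (n-1+j)c) Γ(c) / ( Γ(a + jc) Γ(c + jc) Γ(b + jc + 1) ). -/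
open scoped Real

/-- The iterated circle integral
`∮_{|x_n| = r_n} ⋯ ∮_{|x_1| = r_1} f(x_1, …, x_n) dx_1 ⋯ dx_n`,
each circle centered at `0` and traversed once counterclockwise; the innermost
integral is over the variable of index `0` (i.e. `x_1`). -/
noncomputable def iterCircleIntegral :
    (n : ℕ) → ((Fin n → ℂ) → ℂ) → (Fin n → ℝ) → ℂ
  | 0, f, _ => f ![]
  | n + 1, f, r =>
    ∮ z in C(0, r (Fin.last n)),
      iterCircleIntegral n (fun x => f (Fin.snoc x z)) (fun i => r i.castSucc)

open MeasureTheory Complex in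
theorem ms_torusIntegrable {n : ℕ} {f : (Fin n → ℂ) → ℂ} {R : Fin n → ℝ}
    (hf : Continuous (fun θ => f (torusMap 0 R θ))) : TorusIntegrable f 0 R :=
  hf.continuousOn.integrableOn_compact isCompact_Icc

theorem ms_torusMap_snoc {n : ℕ} (R : Fin (n+1) → ℝ) (i : Fin (n+1)) (t : ℝ) (θ : Fin n → ℝ) :
    torusMap 0 R (i.insertNth t θ) =
      i.insertNth (circleMap 0 (R i) t) (torusMap 0 (R ∘ i.succAbove) θ) := by
  funext j
  refine Fin.succAboveCases i ?_ (fun j => ?_) j <;> simp [torusMap, circleMap]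

theorem ms_cont_insert {n : ℕ} {f : (Fin (n+1) → ℂ) → ℂ} {R : Fin (n+1) → ℝ}
    (hf : Continuous (fun θ => f (torusMap 0 R θ))) (i : Fin (n+1)) :
    Continuous (fun p : ℝ × (Fin n → ℝ) =>
      f (i.insertNth (circleMap 0 (R i) p.1) (torusMap 0 (R ∘ i.succAbove) p.2))) := by
  have : Continuous (fun p : ℝ × (Fin n → ℝ) => (i.insertNth p.1 p.2 : Fin (n+1) → ℝ)) := by
    fun_prop
  have h2 := hf.comp this
  simpa [Function.comp_def, ms_torusMap_snoc] using h2

/-- Fubini with the chosen circle innermost. -/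
theorem ms_torus_inner {n : ℕ} {f : (Fin (n+1) → ℂ) → ℂ} {R : Fin (n+1) → ℝ}
    (hf : Continuous (fun θ => f (torusMap 0 R θ))) (i : Fin (n+1)) :
    torusIntegral f 0 R =
      torusIntegral (fun y => ∮ z in C(0, R i), f (i.insertNth z y)) 0 (R ∘ i.succAbove) := by
  rw [torusIntegral_succAbove (ms_torusIntegrable hf) i]
  have h0 : (0 : Fin (n+1) → ℂ) ∘ i.succAbove = 0 := rfl
  rw [h0]
  simp only [torusIntegral, circleIntegral_def_Icc, Pi.zero_apply]
  simp only [← MeasureTheory.integral_smul]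
  rw [MeasureTheory.integral_integral_swap]
  · congr 1
    funext θ
    congr 1
    funext t
    simp only [smul_eq_mul]; ring
  · rw [Function.uncurry_def, MeasureTheory.Measure.prod_restrict,
      ← MeasureTheory.Measure.volume_eq_prod]
    refine ContinuousOn.integrableOn_compact (isCompact_Icc.prod isCompact_Icc) ?_
    apply Continuous.continuousOn
    have := ms_cont_insert hf i
    simp only [deriv_circleMap]
    simp only [smul_eq_mul]
    refine Continuous.mul ?_ (Continuous.mul ?_ this)
    · fun_prop
    · fun_prop

theorem ms_torus_congr {n : ℕ} {f g : (Fin n → ℂ) → ℂ} {R : Fin n → ℝ}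
    (h : ∀ θ, f (torusMap 0 R θ) = g (torusMap 0 R θ)) :
    torusIntegral f 0 R = torusIntegral g 0 R := by
  simp only [torusIntegral, h]

theorem ms_iter_eq_torus {n : ℕ} : ∀ {f : (Fin n → ℂ) → ℂ} {R : Fin n → ℝ},
    Continuous (fun θ => f (torusMap 0 R θ)) → 
    iterCircleIntegral n f R = torusIntegral f 0 R := by
  induction n with
  | zero =>
    intro f R hf
    rw [torusIntegral_dim0, iterCircleIntegral]
    congr 1
    exact Subsingleton.elim _ _
  | succ n ih =>
    intro f R hf
    rw [torusIntegral_succAbove (ms_torusIntegrable hf) (Fin.last n), iterCircleIntegral]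
    have h0 : (0 : Fin (n+1) → ℂ) ∘ (Fin.last n).succAbove = 0 := rfl
    rw [h0]
    have hR : R ∘ (Fin.last n).succAbove = fun i => R i.castSucc := by
      funext i; simp
    rw [hR]
    simp only [circleIntegral, Pi.zero_apply]
    congr 1
    funext t
    congr 1
    rw [ih]
    · simp
    · have := (ms_cont_insert hf (Fin.last n)).comp (Continuous.prodMk_right t)
      simpa [Function.comp_def, hR] using this

/-- The integral of a partial derivative vanishes. -/
theorem ms_torus_deriv {n : ℕ} {f g : (Fin (n+1) → ℂ) → ℂ} {R : Fin (n+1) → ℝ}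
    (hR : ∀ i, 0 ≤ R i)
    (hf : Continuous (fun θ => f (torusMap 0 R θ))) (i : Fin (n+1))
    (h : ∀ θ, HasDerivAt (fun z => g (Function.update (torusMap 0 R θ) i z))
      (f (torusMap 0 R θ)) (torusMap 0 R θ i)) :
    torusIntegral f 0 R = 0 := by
  rw [ms_torus_inner hf i]
  have : torusIntegral (fun y => (0:ℂ)) 0 (R ∘ i.succAbove) = 0 := by
    simp [torusIntegral]
  refine Eq.trans ?_ this
  apply ms_torus_congr
  intro θ
  apply circleIntegral.integral_eq_zero_of_hasDerivWithinAt (f := fun z => g (i.insertNth z (torusMap 0 (R ∘ i.succAbove) θ))) (hR i)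
  intro z hz
  have hz' : z ∈ Set.range (circleMap 0 (R i)) := by
    rw [range_circleMap, abs_of_nonneg (hR i)]; exact hz
  obtain ⟨t, rfl⟩ := hz'
  have := h (i.insertNth t θ)
  rw [ms_torusMap_snoc] at this
  simp only [Fin.update_insertNth, Fin.insertNth_apply_same] at this
  exact this.hasDerivWithinAt

/-- The integrand. -/
noncomputable def msPhi (n a b m : ℕ) (x : Fin n → ℂ) : ℂ :=
  (∏ i : Fin n, (1 - x i) ^ (-(a : ℤ))) *
    (∏ i : Fin n, (x i) ^ (-(b : ℤ) - 1)) *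
    ∏ i : Fin n, ∏ j ∈ Finset.Ioi i, (x j - x i) ^ (-(m : ℤ))

/-- Points off the polar divisor. -/
structure MsReg {n : ℕ} (x : Fin n → ℂ) : Prop where
  ne0 : ∀ i, x i ≠ 0
  ne1 : ∀ i, 1 - x i ≠ 0
  inj : ∀ i j, i ≠ j → x i - x j ≠ 0

theorem MsReg.perm {n : ℕ} {x : Fin n → ℂ} (h : MsReg x) (w : Equiv.Perm (Fin n)) :
    MsReg (fun i => x (w i)) :=
  ⟨fun _ => h.ne0 _, fun _ => h.ne1 _, fun _ _ hij => h.inj _ _ (fun e => hij (w.injective e))⟩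

theorem ms_norm_torus {n : ℕ} {R : Fin n → ℝ} (hR : ∀ i, 0 < R i) (θ : Fin n → ℝ) (i : Fin n) :
    ‖torusMap 0 R θ i‖ = R i := by
  simp [torusMap, abs_of_pos (hR i)]

theorem ms_reg {n : ℕ} {R : Fin n → ℝ} (hR : ∀ i, 0 < R i) (hmono : StrictMono R)
    (hR1 : ∀ i, R i < 1) (θ : Fin n → ℝ) : MsReg (torusMap 0 R θ) := by
  refine ⟨fun i h => ?_, fun i h => ?_, fun i j hij h => ?_⟩
  · have := ms_norm_torus hR θ i
    rw [h, norm_zero] at this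
    exact (hR i).ne this
  · have := ms_norm_torus hR θ i
    rw [← sub_eq_zero.1 h, norm_one] at this
    exact (hR1 i).ne this.symm
  · have h1 := ms_norm_torus hR θ i
    rw [sub_eq_zero.1 h, ms_norm_torus hR θ j] at h1
    exact hij (hmono.injective h1.symm)

/-- `f` has logarithmic derivative `L` at `x`. -/
def MsLD (f : ℂ → ℂ) (L : ℂ) (x : ℂ) : Prop := HasDerivAt f (f x * L) x

theorem MsLD.mul {f g : ℂ → ℂ} {L M x : ℂ} (hf : MsLD f L x) (hg : MsLD g M x) :
    MsLD (fun z => f z * g z) (L + M) x := by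
  have := HasDerivAt.mul hf hg
  refine HasDerivAt.congr_deriv this ?_
  ring

theorem MsLD.prod {ι : Type*} (s : Finset ι) {f : ι → ℂ → ℂ} {L : ι → ℂ} {x : ℂ}
    (h : ∀ i ∈ s, MsLD (f i) (L i) x) :
    MsLD (fun z => ∏ i ∈ s, f i z) (∑ i ∈ s, L i) x := by
  classical
  induction s using Finset.induction_on with
  | empty => simpa [MsLD] using hasDerivAt_const x (1:ℂ)
  | insert i s hi ih =>
    simp only [Finset.prod_insert hi, Finset.sum_insert hi]
    exact (h i (by simp)).mul (ih (fun j hj => h j (by simp [hj])))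

theorem MsLD.zpow {f : ℂ → ℂ} {f' x : ℂ} (hf : HasDerivAt f f' x) (h0 : f x ≠ 0) (n : ℤ) :
    MsLD (fun z => f z ^ n) (n * f' / f x) x := by
  have := (hasDerivAt_zpow n (f x) (Or.inl h0)).comp x hf
  refine HasDerivAt.congr_deriv this ?_
  rw [zpow_sub_one₀ h0]
  field_simp

theorem ms_coord {n : ℕ} (x : Fin n → ℂ) (k i : Fin n) :
    HasDerivAt (fun z => Function.update x k z i) (if i = k then 1 else 0) (x k) := by
  by_cases h : i = k
  · subst h; simp only [Function.update_self, if_true]; exact hasDerivAt_id (x i)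
  · simpa [h] using hasDerivAt_const (x k) (x i)

theorem ms_sum_aux {n : ℕ} (x : Fin n → ℂ) (k : Fin n) (m : ℂ) :
    ∑ i : Fin n, ∑ j ∈ Finset.Ioi i,
      (-m) * ((if j = k then 1 else 0) - (if i = k then 1 else 0)) / (x j - x i) =
    -m * ∑ j ∈ Finset.univ.erase k, 1 / (x k - x j) := by
  have h1 : ∀ i j : Fin n, (-m) * ((if j = k then (1:ℂ) else 0) - (if i = k then 1 else 0)) / (x j - x i)
      = (if j = k then -m / (x k - x i) else 0) + (if i = k then -m / (x k - x j) else 0) := by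
    intro i j
    by_cases hj : j = k <;> by_cases hi : i = k <;> simp [hi, hj]
    rw [← neg_sub (x k), div_neg]; ring
  simp only [h1, Finset.sum_add_distrib]
  have h2 : (∑ i : Fin n, ∑ j ∈ Finset.Ioi i, if j = k then -m / (x k - x i) else 0)
      = ∑ i ∈ Finset.Iio k, -m / (x k - x i) := by
    simp only [Finset.sum_ite_eq', Finset.mem_Ioi]
    rw [← Finset.sum_filter]
    congr 1; ext; simp
  have h3 : (∑ i : Fin n, ∑ j ∈ Finset.Ioi i, if i = k then -m / (x k - x j) else 0)
      = ∑ j ∈ Finset.Ioi k, -m / (x k - x j) := by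
    rw [Finset.sum_eq_single k]
    · simp
    · intro i _ hi; simp [hi]
    · simp
  rw [h2, h3, ← Finset.sum_union, Finset.mul_sum]
  · apply Finset.sum_congr
    · ext j; simp [lt_or_lt_iff_ne]
    · intros; ring
  · rw [Finset.disjoint_left]; intro j; simp; exact fun h => h.le

theorem ms_phi_LD {n : ℕ} (a b m : ℕ) {x : Fin n → ℂ} (hx : MsReg x) (k : Fin n) :
    MsLD (fun z => msPhi n a b m (Function.update x k z))
      (a / (1 - x k) - (b + 1) / x k - m * ∑ j ∈ Finset.univ.erase k, 1 / (x k - x j)) (x k) := by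
  have hu : ∀ i, Function.update x k (x k) i = x i := by simp
  have h1 := MsLD.prod Finset.univ (fun i (_ : i ∈ Finset.univ) =>
    MsLD.zpow ((hasDerivAt_const (x k) (1:ℂ)).sub (ms_coord x k i))
      (by simpa using hx.ne1 i) (-(a:ℤ)))
  have h2 := MsLD.prod Finset.univ (fun i (_ : i ∈ Finset.univ) =>
    MsLD.zpow (ms_coord x k i)
      (by simpa using hx.ne0 i) (-(b:ℤ) - 1))
  have h3 := MsLD.prod Finset.univ (fun i (_ : i ∈ Finset.univ) =>
    MsLD.prod (Finset.Ioi i) (fun j (hj : j ∈ Finset.Ioi i) =>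
    MsLD.zpow ((ms_coord x k j).sub (ms_coord x k i))
      (by simpa using hx.inj j i (Finset.mem_Ioi.1 hj).ne') (-(m:ℤ))))
  have h4 := (h1.mul h2).mul h3
  simp only [Pi.sub_apply, hu] at h4
  unfold msPhi
  convert h4 using 1
  have e3 := ms_sum_aux x k m
  push_cast
  rw [e3]
  have e1 : ∑ i : Fin n, -(a:ℂ) * (0 - if i = k then 1 else 0) / (1 - x i) = a / (1 - x k) := by
    rw [Finset.sum_eq_single k]
    · simp
    · intro i _ hi; simp [hi]
    · simp
  have e2 : ∑ i : Fin n, (-(b:ℂ) - 1) * (if i = k then 1 else 0) / x i = - ((b + 1) / x k) := by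
    rw [Finset.sum_eq_single k]
    · simp; ring
    · intro i _ hi; simp [hi]
    · simp
  rw [e1, e2]; ring

/-- Partial product of the first `k` variables. -/
noncomputable def msQ {n : ℕ} (k : ℕ) (x : Fin n → ℂ) : ℂ :=
  ∏ i ∈ Finset.univ.filter (fun i : Fin n => (i : ℕ) < k), x i

theorem msQ_succ {n : ℕ} (k : Fin n) (x : Fin n → ℂ) : msQ (k + 1) x = msQ k x * x k := by
  unfold msQ
  have : (Finset.univ.filter (fun i : Fin n => (i : ℕ) < k + 1)) =
      insert k (Finset.univ.filter (fun i : Fin n => (i : ℕ) < k)) := by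
    ext i; simp [Fin.ext_iff]; omega
  rw [this, Finset.prod_insert (by simp), mul_comm]

theorem msQ_swap {n : ℕ} (K : ℕ) (x : Fin n → ℂ) (k j : Fin n) (h : (k : ℕ) < K ↔ (j : ℕ) < K) :
    msQ K (fun i => x (Equiv.swap k j i)) = msQ K x := by
  unfold msQ
  refine Finset.prod_equiv (Equiv.swap k j) ?_ (fun i _ => rfl)
  intro i
  simp only [Finset.mem_filter, Finset.mem_univ, true_and]
  by_cases h1 : i = k
  · subst h1; simpa using h
  by_cases h2 : i = j
  · subst h2; simpa using h.symm
  rw [Equiv.swap_apply_of_ne_of_ne h1 h2]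

/-- `Φ⁻¹ ∂ₖ ((1 - xₖ) xₖ q_k Φ)`. -/
noncomputable def msR {n : ℕ} (a b m : ℕ) (k : Fin n) (x : Fin n → ℂ) : ℂ :=
  (1 - 2 * x k) * msQ k x + a * (x k * msQ k x) - (b + 1) * ((1 - x k) * msQ k x)
    - m * ∑ j ∈ Finset.univ.erase k, (1 - x k) * x k * msQ k x / (x k - x j)

theorem ms_sum_perm {n : ℕ} (f : (Fin n → ℂ) → ℂ) (x : Fin n → ℂ) (s : Equiv.Perm (Fin n)) :
    ∑ w : Equiv.Perm (Fin n), f (fun i => x (w (s i))) =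
      ∑ w : Equiv.Perm (Fin n), f (fun i => x (w i)) :=
  Equiv.sum_comp (Equiv.mulRight s) (fun w : Equiv.Perm (Fin n) => f (fun i => x (w i)))

/-- Symmetrisation of one fraction. -/
theorem ms_sym_one {n : ℕ} {x : Fin n → ℂ} (hx : MsReg x) (k j : Fin n) (hj : j ≠ k) :
    2 * ∑ w : Equiv.Perm (Fin n), (1 - x (w k)) * x (w k) * msQ k (fun i => x (w i)) /
        (x (w k) - x (w j)) =
      if j < k then - ∑ w : Equiv.Perm (Fin n), msQ (k + 1) (fun i => x (w i))
      else ∑ w : Equiv.Perm (Fin n), msQ k (fun i => x (w i)) -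
        2 * ∑ w : Equiv.Perm (Fin n), msQ (k + 1) (fun i => x (w i)) := by
  have e := ms_sum_perm (fun y => (1 - y k) * y k * msQ k y / (y k - y j)) x (Equiv.swap k j)
  simp only [Equiv.swap_apply_left, Equiv.swap_apply_right] at e
  rw [two_mul]
  nth_rewrite 2 [← e]
  rw [← Finset.sum_add_distrib]
  split_ifs with h
  · rw [← Finset.sum_neg_distrib]
    refine Finset.sum_congr rfl (fun w _ => ?_)
    have hne : x (w k) - x (w j) ≠ 0 := (hx.perm w).inj k j hj.symm
    have hne' : x (w j) - x (w k) ≠ 0 := (hx.perm w).inj j k hj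
    have e1 := msQ_succ k (fun i => x (w i))
    have e2 := msQ_succ k (fun i => x (w (Equiv.swap k j i)))
    have e3 := msQ_swap (k + 1) (fun i => x (w i)) k j (by simp; omega)
    simp only [Equiv.swap_apply_left] at e2
    rw [e3] at e2
    rw [mul_assoc, mul_comm (x (w k)), ← e1, mul_assoc, mul_comm (x (w j)), ← e2,
      div_add_div _ _ hne hne', div_eq_iff (mul_ne_zero hne hne')]
    ring
  · have e' := ms_sum_perm (fun y => msQ (k + 1) y) x (Equiv.swap k j)
    rw [two_mul]
    nth_rewrite 2 [← e']
    rw [← Finset.sum_add_distrib, ← Finset.sum_sub_distrib]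
    refine Finset.sum_congr rfl (fun w _ => ?_)
    have hne : x (w k) - x (w j) ≠ 0 := (hx.perm w).inj k j hj.symm
    have hne' : x (w j) - x (w k) ≠ 0 := (hx.perm w).inj j k hj
    have e3 := msQ_swap k (fun i => x (w i)) k j (by simp; omega)
    rw [msQ_succ, msQ_succ, e3]
    simp only [Equiv.swap_apply_left]
    rw [div_add_div _ _ hne hne', div_eq_iff (mul_ne_zero hne hne')]
    ring

theorem ms_sym {n : ℕ} (a b m : ℕ) {x : Fin n → ℂ} (hx : MsReg x) (k : Fin n) :
    ∑ w : Equiv.Perm (Fin n), msR a b m k (fun i => x (w i)) =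
      ((a : ℂ) + b - 1 + (m / 2) * ((n - 1 : ℂ) + (n - 1 - k)))
          * (∑ w : Equiv.Perm (Fin n), msQ (k + 1) (fun i => x (w i)))
      - (b + (m / 2) * (n - 1 - k : ℂ)) * ∑ w : Equiv.Perm (Fin n), msQ k (fun i => x (w i)) := by
  set F0 := ∑ w : Equiv.Perm (Fin n), msQ k (fun i => x (w i)) with hF0
  set F1 := ∑ w : Equiv.Perm (Fin n), msQ (k + 1) (fun i => x (w i)) with hF1
  have hs : ∑ w : Equiv.Perm (Fin n), ∑ j ∈ Finset.univ.erase k,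
      (1 - x (w k)) * x (w k) * msQ k (fun i => x (w i)) / (x (w k) - x (w j)) =
      (k : ℂ) * (-F1 / 2) + (n - 1 - k : ℂ) * ((F0 - 2 * F1) / 2) := by
    rw [Finset.sum_comm]
    have : ∀ j ∈ Finset.univ.erase k, ∑ w : Equiv.Perm (Fin n),
      (1 - x (w k)) * x (w k) * msQ k (fun i => x (w i)) / (x (w k) - x (w j)) =
      if j < k then -F1 / 2 else (F0 - 2 * F1) / 2 := by
      intro j hj
      have := ms_sym_one hx k j (Finset.ne_of_mem_erase hj)
      rw [← hF0, ← hF1] at this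
      split_ifs at this ⊢ <;> linear_combination this / 2
    rw [Finset.sum_congr rfl this, Finset.sum_ite, Finset.sum_const, Finset.sum_const,
      nsmul_eq_mul, nsmul_eq_mul]
    have c1 : (Finset.univ.erase k).filter (fun j => j < k) = Finset.Iio k := by
      ext j; simp; exact fun h => h.ne
    have c2 : (Finset.univ.erase k).filter (fun j => ¬ j < k) = Finset.Ioi k := by
      ext j; simp; omega
    rw [c1, c2, Fin.card_Iio, Fin.card_Ioi]
    have : ((n - 1 - k : ℕ) : ℂ) = n - 1 - k := by
      have := k.2
      rw [Nat.cast_sub (by omega), Nat.cast_sub (by omega)]; simp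
    rw [this]
  have : ∀ w : Equiv.Perm (Fin n), msR a b m k (fun i => x (w i)) =
      ((a:ℂ) + b - 1) * msQ (k+1) (fun i => x (w i)) - b * msQ k (fun i => x (w i))
      - m * ∑ j ∈ Finset.univ.erase k,
      (1 - x (w k)) * x (w k) * msQ k (fun i => x (w i)) / (x (w k) - x (w j)) := by
    intro w
    rw [msR, msQ_succ]; ring
  simp only [this, Finset.sum_sub_distrib, ← Finset.mul_sum]
  rw [hs, ← hF0, ← hF1]
  ring

theorem ms_deriv {n : ℕ} (a b m : ℕ) {x : Fin n → ℂ} (hx : MsReg x) (k : Fin n)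
    (w : Equiv.Perm (Fin n)) :
    HasDerivAt (fun z => (fun y : Fin n → ℂ => (1 - y (w k)) * y (w k) * msQ k (fun i => y (w i)) *
      msPhi n a b m y) (Function.update x (w k) z))
      (msR a b m k (fun i => x (w i)) * msPhi n a b m x) (x (w k)) := by
  have hq : ∀ z, msQ k (fun i => Function.update x (w k) z (w i)) = msQ k (fun i => x (w i)) := by
    intro z
    refine Finset.prod_congr rfl (fun i hi => ?_)
    have : i ≠ k := by rintro rfl; simp at hi
    simp [this]
  have h1 := ms_phi_LD a b m hx (w k)
  unfold MsLD at h1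
  have hid := hasDerivAt_id (x (w k))
  have h2 := ((((hasDerivAt_const (x (w k)) (1:ℂ)).sub hid).mul hid).mul_const
    (msQ k (fun i => x (w i)))).mul h1
  simp only [hq, Function.update_self]
  refine HasDerivAt.congr_deriv h2 ?_
  simp only [Function.update_eq_self, id, Pi.mul_apply, Pi.sub_apply]
  have hs : ∑ j ∈ Finset.univ.erase k, (1 - x (w k)) * x (w k) * msQ k (fun i => x (w i)) /
      (x (w k) - x (w j)) = (1 - x (w k)) * x (w k) * msQ k (fun i => x (w i)) *
      ∑ j ∈ Finset.univ.erase (w k), 1 / (x (w k) - x j) := by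
    rw [Finset.mul_sum]
    refine Finset.sum_equiv w (by simp) (fun i _ => by ring)
  rw [msR, hs]
  have := hx.ne0 (w k)
  have := hx.ne1 (w k)
  field_simp
  ring

theorem ms_cont_torusMap {n : ℕ} (R : Fin n → ℝ) : Continuous (torusMap 0 R) := by
  unfold torusMap
  fun_prop

theorem ms_cont_phi {n : ℕ} (a b m : ℕ) {R : Fin n → ℝ} (hreg : ∀ θ, MsReg (torusMap 0 R θ)) :
    Continuous (fun θ => msPhi n a b m (torusMap 0 R θ)) := by
  have hc : ∀ i, Continuous (fun θ => torusMap 0 R θ i) :=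
    fun i => (continuous_apply i).comp (ms_cont_torusMap R)
  unfold msPhi
  refine ((continuous_finsetProd _ fun i _ => ?_).mul (continuous_finsetProd _ fun i _ => ?_)).mul
    (continuous_finsetProd _ fun i _ => continuous_finsetProd _ fun j hj => ?_)
  · exact (continuous_const.sub (hc i)).zpow₀ _ (fun θ => Or.inl ((hreg θ).ne1 i))
  · exact (hc i).zpow₀ _ (fun θ => Or.inl ((hreg θ).ne0 i))
  · exact ((hc j).sub (hc i)).zpow₀ _
      (fun θ => Or.inl ((hreg θ).inj j i (Finset.mem_Ioi.1 hj).ne'))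

theorem ms_cont_Q {n : ℕ} (K : ℕ) (R : Fin n → ℝ) (w : Equiv.Perm (Fin n)) :
    Continuous (fun θ => msQ K (fun i => torusMap 0 R θ (w i))) := by
  unfold msQ
  exact continuous_finsetProd _ fun i _ => (continuous_apply _).comp (ms_cont_torusMap R)

theorem ms_cont_R {n : ℕ} (a b m : ℕ) {R : Fin n → ℝ} (hreg : ∀ θ, MsReg (torusMap 0 R θ))
    (k : Fin n) (w : Equiv.Perm (Fin n)) :
    Continuous (fun θ => msR a b m k (fun i => torusMap 0 R θ (w i))) := by
  have hc : ∀ i, Continuous (fun θ => torusMap 0 R θ i) :=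
    fun i => (continuous_apply i).comp (ms_cont_torusMap R)
  have hq := ms_cont_Q k R w
  have h1 := hc (w k)
  unfold msR
  refine Continuous.sub (by fun_prop) (continuous_const.mul (continuous_finsetSum _ fun j hj => ?_))
  refine Continuous.div (by fun_prop) (h1.sub (hc (w j))) (fun θ => ?_)
  exact ((hreg θ).perm w).inj k j (Finset.ne_of_mem_erase hj).symm

theorem ms_torus_sum {n : ℕ} {ι : Type*} (s : Finset ι) {f : ι → (Fin n → ℂ) → ℂ} {R : Fin n → ℝ}
    (hf : ∀ i ∈ s, Continuous (fun θ => f i (torusMap 0 R θ))) :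
    torusIntegral (fun x => ∑ i ∈ s, f i x) 0 R = ∑ i ∈ s, torusIntegral (f i) 0 R := by
  simp only [torusIntegral, Finset.smul_sum]
  rw [MeasureTheory.integral_finsetSum]
  intro i hi
  exact (ms_torusIntegrable (hf i hi)).function_integrable

/-- The symmetrised integral with `k` variables inserted. -/
noncomputable def msJ (n a b m : ℕ) (R : Fin n → ℝ) (K : ℕ) : ℂ :=
  torusIntegral (fun x => (∑ w : Equiv.Perm (Fin n), msQ K (fun i => x (w i))) *
    msPhi n a b m x) 0 R

theorem ms_step {n : ℕ} (a b m : ℕ) {R : Fin n → ℝ} (hR : ∀ i, 0 ≤ R i)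
    (hreg : ∀ θ, MsReg (torusMap 0 R θ)) (k : Fin n) :
    (b + (m / 2) * (n - 1 - k : ℂ)) * msJ n a b m R k =
    ((a : ℂ) + b - 1 + (m / 2) * ((n - 1 : ℂ) + (n - 1 - k))) * msJ n a b m R (k + 1) := by
  obtain ⟨n, rfl⟩ : ∃ l, n = l + 1 := ⟨n - 1, by have := k.2; omega⟩
  have hphi := ms_cont_phi a b m hreg
  have h0 : ∀ w : Equiv.Perm (Fin (n+1)),
      torusIntegral (fun x => msR a b m k (fun i => x (w i)) * msPhi (n+1) a b m x) 0 R = 0 := by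
    intro w
    exact ms_torus_deriv (g := fun y : Fin (n+1) → ℂ => (1 - y (w k)) * y (w k) *
        msQ k (fun i => y (w i)) * msPhi (n+1) a b m y) hR ((ms_cont_R a b m hreg k w).mul hphi) (w k)
      (fun θ => ms_deriv a b m (hreg θ) k w)
  have hsum := ms_torus_sum (R := R) Finset.univ
    (f := fun (w : Equiv.Perm (Fin (n+1))) x => msR a b m k (fun i => x (w i)) * msPhi (n+1) a b m x)
    (fun w _ => (ms_cont_R a b m hreg k w).mul hphi)
  simp only [h0, Finset.sum_const_zero] at hsum
  have hJ : ∀ K : ℕ, ∀ C : ℂ, Continuous (fun θ => C * ((∑ w : Equiv.Perm (Fin (n+1)),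
      msQ K (fun i => torusMap 0 R θ (w i))) * msPhi (n+1) a b m (torusMap 0 R θ))) := by
    intro K C
    exact continuous_const.mul ((continuous_finsetSum _ fun w _ => ms_cont_Q K R w).mul hphi)
  have hcong := ms_torus_congr (R := R)
    (f := fun x => ∑ w : Equiv.Perm (Fin (n+1)),
      msR a b m k (fun i => x (w i)) * msPhi (n+1) a b m x)
    (g := fun x => ((a : ℂ) + b - 1 + (m / 2) * (((n+1 : ℕ) - 1 : ℂ) + ((n+1 : ℕ) - 1 - k))) *
        ((∑ w : Equiv.Perm (Fin (n+1)), msQ (k + 1) (fun i => x (w i))) * msPhi (n+1) a b m x) -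
      (b + (m / 2) * ((n+1 : ℕ) - 1 - k : ℂ)) *
        ((∑ w : Equiv.Perm (Fin (n+1)), msQ k (fun i => x (w i))) * msPhi (n+1) a b m x))
    (fun θ => by
      rw [← Finset.sum_mul, ms_sym a b m (hreg θ) k]; ring)
  rw [hsum, torusIntegral_sub (ms_torusIntegrable (hJ _ _)) (ms_torusIntegrable (hJ _ _)),
    torusIntegral_const_mul, torusIntegral_const_mul] at hcong
  unfold msJ
  linear_combination hcong

theorem ms_J_zero (n a b m : ℕ) (R : Fin n → ℝ) :
    msJ n a b m R 0 = n.factorial * torusIntegral (msPhi n a b m) 0 R := by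
  unfold msJ
  rw [← torusIntegral_const_mul]
  congr 1
  funext x
  simp [msQ, Finset.card_univ, Fintype.card_perm]

theorem ms_J_top (n a b m : ℕ) {R : Fin n → ℝ} (hreg : ∀ θ, MsReg (torusMap 0 R θ)) :
    msJ n a (b+1) m R n = n.factorial * torusIntegral (msPhi n a b m) 0 R := by
  unfold msJ
  rw [← torusIntegral_const_mul]
  apply ms_torus_congr
  intro θ
  have hx := hreg θ
  set x := torusMap 0 R θ
  have h1 : ∀ w : Equiv.Perm (Fin n), msQ n (fun i => x (w i)) = ∏ i, x i := by
    intro w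
    simp only [msQ, Fin.is_lt, Finset.filter_true]
    exact Equiv.prod_comp w x
  simp only [h1, Finset.sum_const, Finset.card_univ, Fintype.card_perm, Fintype.card_fin,
    nsmul_eq_mul, msPhi]
  have h2 : ∏ i : Fin n, x i ^ (-(b:ℤ) - 1) =
      (∏ i, x i) * ∏ i : Fin n, x i ^ (-((b+1 : ℕ):ℤ) - 1) := by
    rw [← Finset.prod_mul_distrib]
    refine Finset.prod_congr rfl (fun i _ => ?_)
    rw [← zpow_one_add₀ (hx.ne0 i)]
    congr 1; push_cast; ring
  rw [h2]; ring

theorem ms_rec (n a b m : ℕ) {R : Fin n → ℝ} (hR : ∀ i, 0 ≤ R i)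
    (hreg : ∀ θ, MsReg (torusMap 0 R θ)) :
    (∏ j ∈ Finset.range n, ((b + 1 : ℂ) + (m / 2) * j)) * torusIntegral (msPhi n a (b+1) m) 0 R =
    (∏ j ∈ Finset.range n, ((a : ℂ) + b + (m / 2) * ((n - 1 : ℂ) + j))) *
      torusIntegral (msPhi n a b m) 0 R := by
  have key : ∀ K : ℕ, K ≤ n →
      (∏ k ∈ Finset.range K, ((b + 1 : ℂ) + (m / 2) * (n - 1 - k : ℂ))) * msJ n a (b+1) m R 0 =
      (∏ k ∈ Finset.range K, ((a : ℂ) + b + (m / 2) * ((n - 1 : ℂ) + (n - 1 - k)))) *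
        msJ n a (b+1) m R K := by
    intro K
    induction K with
    | zero => simp
    | succ K ih =>
      intro hK
      have h1 := ms_step a (b+1) m hR hreg ⟨K, hK⟩
      simp only at h1
      push_cast at h1
      have h2 := ih (by omega)
      rw [Finset.prod_range_succ, Finset.prod_range_succ]
      linear_combination ((b + 1 : ℂ) + (m / 2) * (n - 1 - K : ℂ)) * h2 +
        (∏ k ∈ Finset.range K, ((a : ℂ) + b + (m / 2) * ((n - 1 : ℂ) + (n - 1 - k)))) * h1
  have h := key n le_rfl
  have hcast : ∀ k ∈ Finset.range n, ((n - 1 - k : ℕ) : ℂ) = n - 1 - k := by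
    intro k hk
    have := Finset.mem_range.1 hk
    rw [Nat.cast_sub (by omega), Nat.cast_sub (by omega)]; simp
  have p1 : ∏ k ∈ Finset.range n, ((b + 1 : ℂ) + (m / 2) * (n - 1 - k : ℂ)) =
      ∏ j ∈ Finset.range n, ((b + 1 : ℂ) + (m / 2) * j) := by
    rw [← Finset.prod_range_reflect]
    exact Finset.prod_congr rfl (fun k hk => by rw [hcast k hk]; ring)
  have p2 : ∏ k ∈ Finset.range n, ((a : ℂ) + b + (m / 2) * ((n - 1 : ℂ) + (n - 1 - k))) =
      ∏ j ∈ Finset.range n, ((a : ℂ) + b + (m / 2) * ((n - 1 : ℂ) + j)) := by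
    rw [← Finset.prod_range_reflect]
    exact Finset.prod_congr rfl (fun k hk => by rw [hcast k hk]; ring)
  rw [p1, p2, ms_J_zero, ms_J_top n a b m hreg] at h
  have hf : (n.factorial : ℂ) ≠ 0 := by exact_mod_cast n.factorial_ne_zero
  apply mul_left_cancel₀ hf
  linear_combination h

theorem ms_base (n a m : ℕ) {R : Fin (n+1) → ℝ} (hR : ∀ i, 0 < R i) (hmono : StrictMono R)
    (hR1 : ∀ i, R i < 1) :
    torusIntegral (msPhi (n+1) a 0 m) 0 R =
      (2 * π * Complex.I) * torusIntegral (msPhi n a m m) 0 (R ∘ Fin.succ) := by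
  rw [ms_torus_inner (ms_cont_phi a 0 m (ms_reg hR hmono hR1)) 0, ← torusIntegral_const_mul]
  have hs : R ∘ (0 : Fin (n+1)).succAbove = R ∘ Fin.succ := by
    funext i; simp
  rw [hs]
  apply ms_torus_congr
  intro θ
  have hny := ms_norm_torus (R := R ∘ Fin.succ) (fun i => hR _) θ
  have hreg : MsReg (torusMap 0 (R ∘ Fin.succ) θ) :=
    ms_reg (fun i => hR _) (hmono.comp (Fin.strictMono_succ)) (fun i => hR1 _) θ
  set y := torusMap 0 (R ∘ Fin.succ) θ
  set h : ℂ → ℂ := fun z => (1 - z) ^ (-(a:ℤ)) * (∏ j : Fin n, (y j - z) ^ (-(m:ℤ))) *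
    ((∏ i : Fin n, (1 - y i) ^ (-(a : ℤ))) *
    (∏ i : Fin n, (y i) ^ (-1 : ℤ)) *
    ∏ i : Fin n, ∏ j ∈ Finset.Ioi i, (y j - y i) ^ (-(m : ℤ))) with hh
  have e1 : ∀ z, msPhi (n+1) a 0 m ((0 : Fin (n+1)).insertNth z y) = (z - 0)⁻¹ • h z := by
    intro z
    simp only [msPhi, hh, Fin.insertNth_zero', Fin.prod_univ_succ, Fin.cons_zero, Fin.cons_succ,
      Fin.prod_Ioi_zero, Fin.prod_Ioi_succ, smul_eq_mul, sub_zero, Nat.cast_zero, neg_zero, zero_sub,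
      zpow_neg_one]
    ring
  simp only [e1]
  have hd : DifferentiableOn ℂ h (Metric.closedBall 0 (R 0)) := by
    intro z hz
    have hz' : ‖z‖ ≤ R 0 := by simpa using hz
    apply DifferentiableAt.differentiableWithinAt
    have n1 : 1 - z ≠ 0 := by
      intro e
      rw [← sub_eq_zero.1 e, norm_one] at hz'
      exact absurd (hR1 0) (not_lt.2 hz')
    have n2 : ∀ j, y j - z ≠ 0 := by
      intro j e
      rw [← sub_eq_zero.1 e, hny j] at hz'
      exact absurd (hmono (Fin.succ_pos j)) (not_lt.2 hz')
    refine DifferentiableAt.mul_const (DifferentiableAt.mul ?_ ?_) _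
    · exact DifferentiableAt.zpow (by fun_prop) (Or.inl n1)
    · refine DifferentiableAt.fun_finsetProd (fun j _ => ?_)
      exact DifferentiableAt.zpow (by fun_prop) (Or.inl (n2 j))
  have hc := hd.circleIntegral_sub_inv_smul (w := 0) (by simpa using hR 0)
  rw [hc]
  simp only [hh, smul_eq_mul, msPhi, sub_zero, one_zpow, one_mul]
  have : ∏ i : Fin n, (y i) ^ (-(m:ℤ) - 1) =
      (∏ i : Fin n, (y i) ^ (-(m:ℤ))) * ∏ i : Fin n, (y i) ^ (-1 : ℤ) := by
    rw [← Finset.prod_mul_distrib]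
    refine Finset.prod_congr rfl (fun i _ => ?_)
    rw [← zpow_add₀ (hreg.ne0 i)]; rfl
  rw [this]; ring

theorem ms_S_rec (n : ℕ) {a b c : ℝ} (ha : 0 < a) (hb : 0 ≤ b) (hc : 0 < c) :
    (∏ j ∈ Finset.range n, (b + 1 + c * j)) * morrisSelberg n a (b + 1) c =
    (∏ j ∈ Finset.range n, (a + b + c * ((n : ℝ) - 1 + j))) * morrisSelberg n a b c := by
  unfold morrisSelberg
  rw [mul_left_comm, mul_left_comm (∏ j ∈ Finset.range n, (a + b + c * ((n : ℝ) - 1 + j))),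
    ← Finset.prod_mul_distrib, ← Finset.prod_mul_distrib]
  congr 1
  refine Finset.prod_congr rfl (fun j hj => ?_)
  have hn : (1:ℝ) ≤ n := by
    have := Finset.mem_range.1 hj
    exact_mod_cast (by omega : 1 ≤ n)
  have hj0 : (0:ℝ) ≤ j := Nat.cast_nonneg j
  have p1 : 0 < a + b + ((n : ℝ) - 1 + j) * c := by
    have : 0 ≤ ((n : ℝ) - 1 + j) * c := mul_nonneg (by linarith) hc.le
    linarith
  have p2 : 0 < b + (j:ℝ) * c + 1 := by positivity
  have e1 : Real.Gamma (a + (b + 1) + ((n : ℝ) - 1 + j) * c) =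
      (a + b + ((n : ℝ) - 1 + j) * c) * Real.Gamma (a + b + ((n : ℝ) - 1 + j) * c) := by
    rw [← Real.Gamma_add_one p1.ne']; congr 1; ring
  have e2 : Real.Gamma (b + 1 + j * c + 1) =
      (b + j * c + 1) * Real.Gamma (b + j * c + 1) := by
    rw [← Real.Gamma_add_one p2.ne']; congr 1; ring
  have q1 : Real.Gamma (b + j * c + 1) ≠ 0 := (Real.Gamma_pos_of_pos p2).ne'
  have q2 : Real.Gamma (a + j * c) ≠ 0 := (Real.Gamma_pos_of_pos (by positivity)).ne'
  have q3 : Real.Gamma (c + j * c) ≠ 0 := (Real.Gamma_pos_of_pos (by positivity)).ne'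
  rw [e1, e2]
  rw [show b + 1 + c * (j:ℝ) = b + j * c + 1 by ring,
    show a + b + c * ((n : ℝ) - 1 + j) = a + b + ((n : ℝ) - 1 + j) * c by ring]
  have p3 := p2.ne'
  generalize b + j * c + 1 = u at *
  generalize a + b + ((n : ℝ) - 1 + j) * c = v at *
  field_simp

theorem ms_S_base (n : ℕ) {a c : ℝ} (ha : 0 < a) (hc : 0 < c) :
    morrisSelberg (n+1) a 0 c = morrisSelberg n a (2 * c) c := by
  set G : ℕ → ℝ := fun k => Real.Gamma (a + k * c) with hG
  set H : ℕ → ℝ := fun k => Real.Gamma (k * c + 1) with hH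
  set E : ℕ → ℝ := fun k => Real.Gamma (c + k * c) with hE
  have g0 : ∀ k, G k ≠ 0 := fun k => (Real.Gamma_pos_of_pos (by positivity)).ne'
  have h0 : ∀ k, H k ≠ 0 := fun k => (Real.Gamma_pos_of_pos (by positivity)).ne'
  have e0 : ∀ k, E k ≠ 0 := fun k => (Real.Gamma_pos_of_pos (by positivity)).ne'
  have c0 : Real.Gamma c ≠ 0 := (Real.Gamma_pos_of_pos hc).ne'
  have l : morrisSelberg (n+1) a 0 c = (1 / ((n+1).factorial : ℝ)) *
      ((∏ j ∈ Finset.range (n+1), G (n + j)) * Real.Gamma c ^ (n+1) /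
        ((∏ j ∈ Finset.range (n+1), G j) * (∏ j ∈ Finset.range (n+1), E j) *
          (∏ j ∈ Finset.range (n+1), H j))) := by
    unfold morrisSelberg
    rw [Finset.prod_div_distrib, Finset.prod_mul_distrib, Finset.prod_mul_distrib,
      Finset.prod_mul_distrib, Finset.prod_const, Finset.card_range]
    simp [hG, hH, hE]
  have r : morrisSelberg n a (2 * c) c = (1 / (n.factorial : ℝ)) *
      ((∏ j ∈ Finset.range n, G (n + (j + 1))) * Real.Gamma c ^ n /
        ((∏ j ∈ Finset.range n, G j) * (∏ j ∈ Finset.range n, E j) *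
          (∏ j ∈ Finset.range n, H (j + 1 + 1)))) := by
    unfold morrisSelberg
    rw [Finset.prod_div_distrib, Finset.prod_mul_distrib, Finset.prod_mul_distrib,
      Finset.prod_mul_distrib, Finset.prod_const, Finset.card_range]
    simp only [hG, hH, hE]
    push_cast
    have u1 : ∀ j : ℕ, a + 2 * c + ((n:ℝ) - 1 + j) * c = a + (n + (j + 1)) * c := fun j => by ring
    have u2 : ∀ j : ℕ, 2 * c + (j:ℝ) * c + 1 = (j + 1 + 1) * c + 1 := fun j => by ring
    simp only [u1, u2]
  have hp : (∏ j ∈ Finset.range (n+1), H j) * H (n+1) =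
      (∏ j ∈ Finset.range n, H (j + 1 + 1)) * H 1 := by
    rw [← Finset.prod_range_succ, Finset.prod_range_succ', Finset.prod_range_succ']
    simp [hH]
  have hH1 : H 1 = c * Real.Gamma c := by
    simp only [hH]; rw [← Real.Gamma_add_one hc.ne']; simp
  have hHn : H (n+1) = (n+1) * c * E n := by
    simp only [hH, hE]
    rw [Real.Gamma_add_one (by positivity)]; push_cast
    congr 2; ring
  rw [l, r, Finset.prod_range_succ', Finset.prod_range_succ G, Finset.prod_range_succ E,
    Nat.factorial_succ]
  have z1 : (∏ j ∈ Finset.range n, G j) ≠ 0 := Finset.prod_ne_zero_iff.2 fun j _ => g0 j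
  have z2 : (∏ j ∈ Finset.range n, E j) ≠ 0 := Finset.prod_ne_zero_iff.2 fun j _ => e0 j
  have z3 : (∏ j ∈ Finset.range (n+1), H j) ≠ 0 := Finset.prod_ne_zero_iff.2 fun j _ => h0 j
  have z4 : (∏ j ∈ Finset.range n, H (j+1+1)) ≠ 0 := Finset.prod_ne_zero_iff.2 fun j _ => h0 _
  have z5 : (n.factorial : ℝ) ≠ 0 := by exact_mod_cast n.factorial_ne_zero
  have z6 : (n + 1 : ℝ) ≠ 0 := by positivity
  have gn := g0 n
  have en := e0 n
  rw [hH1, hHn] at hp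
  generalize (∏ j ∈ Finset.range (n+1), H j) = X at *
  generalize (∏ j ∈ Finset.range n, H (j+1+1)) = Y at *
  have hp' : X * ((n + 1) * E n) = Y * Real.Gamma c := by
    apply mul_left_cancel₀ hc.ne'
    linear_combination hp
  push_cast
  rw [add_zero, pow_succ, ← sub_eq_zero]
  field_simp
  linear_combination (-(∏ x ∈ Finset.range n, G (n + (x + 1))) * Real.Gamma c ^ n) * hp'

theorem ms_main (a m : ℕ) (ha : 0 < a) (hm : 0 < m) (n : ℕ) : ∀ (b : ℕ) (R : Fin n → ℝ),
    (∀ i, 0 < R i) → StrictMono R → (∀ i, R i < 1) →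
    torusIntegral (msPhi n a b m) 0 R =
      (2 * π * Complex.I) ^ n * (morrisSelberg n (a : ℝ) (b : ℝ) ((m : ℝ) / 2) : ℂ) := by
  have ha' : (0:ℝ) < a := by exact_mod_cast ha
  have hc : (0:ℝ) < (m:ℝ)/2 := by positivity
  induction n with
  | zero => intro b R _ _ _; simp [msPhi, morrisSelberg]
  | succ n ih =>
    intro b
    induction b with
    | zero =>
      intro R h1 h2 h3
      rw [ms_base n a m h1 h2 h3, ih m (R ∘ Fin.succ) (fun i => h1 _)
        (h2.comp (Fin.strictMono_succ)) (fun i => h3 _), Nat.cast_zero, ms_S_base n ha' hc]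
      rw [show 2 * ((m:ℝ) / 2) = m by ring]
      ring
    | succ b ihb =>
      intro R h1 h2 h3
      have hr := ms_rec (n+1) a b m (fun i => (h1 i).le) (ms_reg h1 h2 h3)
      rw [ihb R h1 h2 h3] at hr
      have hs := ms_S_rec (n+1) (b := b) ha' (Nat.cast_nonneg b) hc
      have hsC := congrArg (fun t : ℝ => (t : ℂ)) hs
      push_cast at hsC hr ⊢
      have hne : (∏ j ∈ Finset.range (n+1), ((b + 1 : ℂ) + (m / 2) * j)) ≠ 0 := by
        refine Finset.prod_ne_zero_iff.2 fun j _ => ?_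
        have : (0:ℝ) < (b + 1 : ℝ) + (m / 2) * j := by positivity
        have h5 := Complex.ofReal_ne_zero.2 this.ne'
        push_cast at h5
        exact h5
      apply mul_left_cancel₀ hne
      rw [hr, mul_left_comm, mul_left_comm _ ((2 * (π:ℂ) * Complex.I) ^ (n+1)), hsC]

/-- **The contour-integral form of the Morris–Selberg identity**: for positive
integers `a`, `m`, a nonnegative integer `b`, `c := m/2`, and radii
`0 < r_1 < r_2 < ⋯ < r_n < 1`,
`(1/(2πi))^n ∮_{|x_n|=r_n} ⋯ ∮_{|x_1|=r_1} ∏ (1-x_i)^{-a} ∏ x_i^{-b-1}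
   ∏_{i<j} (x_j-x_i)^{-m} dx_1 ⋯ dx_n = S_n(a,b,c)`. -/
theorem morris_selberg_contour_integral (n : ℕ) (hn : 0 < n) (a : ℕ) (ha : 0 < a)
    (b : ℕ) (m : ℕ) (hm : 0 < m) (r : Fin n → ℝ) (hr0 : ∀ i, 0 < r i)
    (hrmono : StrictMono r) (hr1 : ∀ i, r i < 1) :
    (1 / (2 * (π : ℂ) * Complex.I)) ^ n *
      iterCircleIntegral n
        (fun x =>
          (∏ i : Fin n, (1 - x i) ^ (-(a : ℤ))) *
            (∏ i : Fin n, (x i) ^ (-(b : ℤ) - 1)) *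
            ∏ i : Fin n, ∏ j ∈ Finset.Ioi i, (x j - x i) ^ (-(m : ℤ))) r =
    (morrisSelberg n (a : ℝ) (b : ℝ) ((m : ℝ) / 2) : ℂ) := by
  have hreg := ms_reg hr0 hrmono hr1
  have h1 : iterCircleIntegral n (msPhi n a b m) r = torusIntegral (msPhi n a b m) 0 r :=
    ms_iter_eq_torus (ms_cont_phi a b m hreg)
  rw [ms_main a m ha hm n b r hr0 hrmono hr1] at h1
  unfold msPhi at h1
  rw [h1, ← mul_assoc, ← mul_pow]
  have : (2 * (π : ℂ) * Complex.I) ≠ 0 := Complex.two_pi_I_ne_zero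
  rw [one_div_mul_cancel this, one_pow, one_mul]
end
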